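/- arXiv:2310.16476 — 5 statements merged into one kernel-verified Lean document; each statement's English description precedes it below -/
import Mathlib

section
/- Let r, N ≥ 1, set M := 6rN², let m ≥ 1, and let K ∈ H_m^𝓡 be a resonant homogeneous polynomial of degree 2m whose coefficients satisfy K_𝐣 = 0 whenever μ₁(𝐣) ≤ M. Then for all z ∈ 𝒢: ‖Π_M X_K(z)‖_σ ≤ 2m · ‖K‖_{ℓ∞} · e^{−σN^θ} · ‖z‖_σ^{2m−1}. -/
noncomputable section

attribute [local instance] Classical.propDecidable

open scoped BigOperators

/-- The Gevrey weight `e^(σ |a|^θ)`. -/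
def wt (σ θ : ℝ) (a : ℤ) : ℝ := Real.exp (σ * |(a : ℝ)| ^ θ)

/-- The Gevrey norm `‖z‖_σ = 2 ∑_a e^(σ|a|^θ) |z_a|`. -/
def gNorm (σ θ : ℝ) (z : ℤ → ℂ) : ℝ := 2 * ∑' a : ℤ, wt σ θ a * ‖z a‖

/-- Membership in the Gevrey space `𝒢`. -/
def inG (σ θ : ℝ) (z : ℤ → ℂ) : Prop := Summable fun a : ℤ => wt σ θ a * ‖z a‖

/-- `z_{(δ,a)}`: `z_a` if `δ = 1`, the conjugate if `δ = -1`. -/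
def idxVal (z : ℤ → ℂ) (p : ℤ × ℤ) : ℂ :=
  if p.1 = 1 then z p.2 else (starRingEnd ℂ) (z p.2)

/-- The monomial `z_𝐣`. -/
def zProd {n : ℕ} (z : ℤ → ℂ) (j : Fin n → ℤ × ℤ) : ℂ := ∏ α, idxVal z (j α)

/-- The signs of the multi-index belong to `𝕌₂ = {-1, 1}`. -/
def isU2 {n : ℕ} (j : Fin n → ℤ × ℤ) : Prop := ∀ α, (j α).1 = 1 ∨ (j α).1 = -1

/-- Zero momentum multi-indices (the set `M_m`, with `n = 2m`). -/
def inM {n : ℕ} (j : Fin n → ℤ × ℤ) : Prop :=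
  isU2 j ∧ ∑ α, (j α).1 = 0 ∧ ∑ α, (j α).1 * (j α).2 = 0

/-- Resonant multi-indices (the set `R_m`, with `n = 2m`). -/
def inR {n : ℕ} (j : Fin n → ℤ × ℤ) : Prop :=
  inM j ∧ ∑ α, (j α).1 * (j α).2 ^ 2 = 0

/-- Integrable multi-indices: the entries can be paired as `{(δ,a), (-δ,a)}`. -/
def integ {n : ℕ} (j : Fin n → ℤ × ℤ) : Prop :=
  ∃ φ : Equiv.Perm (Fin n), ∀ α, j (φ α) = (-(j α).1, (j α).2)

/-- `⟨a⟩ = max(1, |a|)`. -/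
def brk (a : ℤ) : ℕ := max 1 a.natAbs

/-- The modulated frequencies `ω_𝐣^M(z)` with finite cut-off `M`. -/
def omegaM (M : ℝ) {n : ℕ} (j : Fin n → ℤ × ℤ) (z : ℤ → ℂ) : ℝ :=
  ∑ β, ((j β).1 : ℝ) *
    ∑' a : ℤ, if a ≠ (j β).2 ∧ |(a : ℝ)| ≤ M then
      ‖z a‖ ^ 2 / ((a : ℝ) - ((j β).2 : ℝ)) ^ 2 else 0

/-- The modulated frequencies `ω_𝐣^∞(z)`. -/
def omegaInf {n : ℕ} (j : Fin n → ℤ × ℤ) (z : ℤ → ℂ) : ℝ :=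
  ∑ β, ((j β).1 : ℝ) *
    ∑' a : ℤ, if a ≠ (j β).2 then
      ‖z a‖ ^ 2 / ((a : ℝ) - ((j β).2 : ℝ)) ^ 2 else 0

/-- The projection `Π_M` on the modes `|a| ≤ M`. -/
def PiM (M : ℝ) (z : ℤ → ℂ) : ℤ → ℂ := fun a => if |(a : ℝ)| ≤ M then z a else 0

/-- The optimal order `r_ε`. -/
def rEps (σ θ ε : ℝ) : ℕ :=
  Nat.floor ((min 1 σ * θ * (1 - θ) / 500) * Real.log ε⁻¹ / Real.log (Real.log ε⁻¹))

/-- The truncation parameter `N_ε`. -/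
def NEps (θ ε : ℝ) : ℝ := Real.log ε⁻¹ ^ ((2 : ℝ) / θ)

/-- The truncation parameter `L_ε = 6 r_ε N_ε²`. -/
def LEps (σ θ ε : ℝ) : ℝ := 6 * (rEps σ θ ε : ℝ) * NEps θ ε ^ 2

/-- `δ_ε = ε^(5/2)`. -/
def dEps (ε : ℝ) : ℝ := ε ^ ((5 : ℝ) / 2)

/-- Membership in the non-resonant set `𝔙_δ^{r,M}`: for every non-integrable resonant
multi-index `𝐣` with at most `r` entries and `μ₁(𝐣) ≤ M`, one has `|ω_𝐣^M(z)| > δ`. -/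
def inV (δ r M : ℝ) (z : ℤ → ℂ) : Prop :=
  ∀ m : ℕ, 1 ≤ m → ∀ j : Fin (2 * m) → ℤ × ℤ,
    inR j → ¬ integ j → (2 * m : ℝ) ≤ r → (∀ β, (brk ((j β).2) : ℝ) ≤ M) →
    δ < |omegaM M j z|

/-- The set `Θ_ε` of good initial data. -/
def inTheta (σ θ ε : ℝ) (z : ℤ → ℂ) : Prop :=
  inV (10 * dEps ε) (6 * (rEps σ θ ε : ℝ)) (LEps σ θ ε) (PiM (LEps σ θ ε) z)


/-- The `ℓ∞` norm of the coefficients of a polynomial. -/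
def supNorm {n : ℕ} (P : (Fin n → ℤ × ℤ) → ℂ) : ℝ := ⨆ j, ‖P j‖

/-- Membership in `H_m^𝓡` (with `n = 2m`): reality, symmetry, finite `ℓ∞` norm and
support in the resonant multi-indices `R_m`. -/
def inHR {n : ℕ} (K : (Fin n → ℤ × ℤ) → ℂ) : Prop :=
  (∀ j : Fin n → ℤ × ℤ, (starRingEnd ℂ) (K j) = K (fun α => (-(j α).1, (j α).2))) ∧
  (∀ (j : Fin n → ℤ × ℤ) (φ : Equiv.Perm (Fin n)), K (j ∘ φ) = K j) ∧
  BddAbove (Set.range fun j => ‖K j‖) ∧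
  (∀ j : Fin n → ℤ × ℤ, K j ≠ 0 → inR j)

/-- The Poisson bracket `{I_ℓ, K}(z) = ∑_𝐣 K_𝐣 ⬝ i(n₋(𝐣,ℓ) - n₊(𝐣,ℓ)) ⬝ z_𝐣`. -/
def actionBracket {n : ℕ} (K : (Fin n → ℤ × ℤ) → ℂ) (ℓ : ℤ) (z : ℤ → ℂ) : ℂ :=
  ∑' j : Fin n → ℤ × ℤ,
    K j * (Complex.I *
      (((Finset.univ.filter fun α => j α = ((-1 : ℤ), ℓ)).card : ℂ) -
        ((Finset.univ.filter fun α => j α = ((1 : ℤ), ℓ)).card : ℂ))) * zProd z j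


/-- The Hamiltonian vector field of a polynomial with coefficients `P`, evaluated at the
index `p = (δ₀, a₀) ∈ 𝕌₂×ℤ` (here `n = 2m`, so the prefactor is `n = 2m`). -/
def XP {n : ℕ} (hn : 0 < n) (P : (Fin n → ℤ × ℤ) → ℂ) (z : ℤ → ℂ) (p : ℤ × ℤ) : ℂ :=
  (n : ℂ) * Complex.I * (p.1 : ℂ) *
    ∑' j : Fin n → ℤ × ℤ,
      if inM j ∧ j ⟨0, hn⟩ = (-p.1, p.2) then
        P j * ∏ α ∈ Finset.univ.erase (⟨0, hn⟩ : Fin n), idxVal z (j α)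
      else 0

theorem rpow_le_sum_abs_rpow {ι : Type*} (s : Finset ι) (x : ι → ℝ) {θ N : ℝ}
    (hθ : 0 < θ) (hθ' : θ ≤ 2) (hN : 0 ≤ N) (h : N ^ 2 ≤ ∑ i ∈ s, x i ^ 2) :
    N ^ θ ≤ ∑ i ∈ s, |x i| ^ θ := by
  have hsub : (∑ i ∈ s, x i ^ 2) ^ (θ / 2) ≤ ∑ i ∈ s, (x i ^ 2) ^ (θ / 2) := by
    refine Finset.le_sum_of_subadditive_on_pred (fun y : ℝ => y ^ (θ / 2)) (fun y => 0 ≤ y) ?_ ?_ ?_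
      _ ?_
    · simp [Real.zero_rpow (by positivity : θ / 2 ≠ 0)]
    · intro a b ha hb
      exact Real.rpow_add_le_add_rpow ha hb (by positivity) (by linarith)
    · intro a b ha hb
      positivity
    · intro i _
      positivity
  have hpow : ∀ y : ℝ, (y ^ 2) ^ (θ / 2) = |y| ^ θ := by
    intro y
    rw [← sq_abs, ← Real.rpow_natCast, ← Real.rpow_mul (abs_nonneg y)]
    congr 1
    push_cast
    ring
  simp only [hpow] at hsub
  calc N ^ θ = (N ^ 2) ^ (θ / 2) := by rw [hpow, abs_of_nonneg hN]
    _ ≤ (∑ i ∈ s, x i ^ 2) ^ (θ / 2) := by gcongr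
    _ ≤ _ := hsub

theorem brk_le_iff {a : ℤ} {M : ℝ} (hM : 1 ≤ M) : (brk a : ℝ) ≤ M ↔ |(a : ℝ)| ≤ M := by
  simp [brk, Nat.cast_natAbs, hM]

/-- A resonant multi-index with a low first entry and another high entry satisfies an improved
subadditivity estimate. -/
theorem abs_rpow_add_le_of_inR {k : ℕ} {j : Fin (k + 1) → ℤ × ℤ} (hj : inR j) {θ N M : ℝ}
    (hθ : 0 < θ) (hθ' : θ ≤ 2) (hN : 0 ≤ N) (hNM : N ^ 2 ≤ M)
    (h0 : |((j 0).2 : ℝ)| ≤ M) (β : Fin k) (hβ : M < |((j β.succ).2 : ℝ)|) :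
    |((j 0).2 : ℝ)| ^ θ + N ^ θ ≤ ∑ i : Fin k, |((j i.succ).2 : ℝ)| ^ θ := by
  have hU : ∀ α, ((j α).1 : ℝ) = 1 ∨ ((j α).1 : ℝ) = -1 := fun α =>
    (hj.1.1 α).imp (fun h => by simp [h]) (fun h => by simp [h])
  have hres : (∑ α, ((j α).1 : ℝ) * ((j α).2 : ℝ) ^ 2) = 0 := by exact_mod_cast hj.2
  rw [Fin.sum_univ_succ, ← Finset.add_sum_erase _ _ (Finset.mem_univ β)] at hres
  rw [← Finset.add_sum_erase _ _ (Finset.mem_univ β)]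
  have hup : ∑ i ∈ Finset.univ.erase β, ((j i.succ).1 : ℝ) * ((j i.succ).2 : ℝ) ^ 2 ≤
      ∑ i ∈ Finset.univ.erase β, ((j i.succ).2 : ℝ) ^ 2 := by
    refine Finset.sum_le_sum fun i _ => ?_
    rcases hU i.succ with h | h <;> rw [h] <;> nlinarith [sq_nonneg ((j i.succ).2 : ℝ)]
  have hlow : -∑ i ∈ Finset.univ.erase β, ((j i.succ).2 : ℝ) ^ 2 ≤
      ∑ i ∈ Finset.univ.erase β, ((j i.succ).1 : ℝ) * ((j i.succ).2 : ℝ) ^ 2 := by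
    rw [← Finset.sum_neg_distrib]
    refine Finset.sum_le_sum fun i _ => ?_
    rcases hU i.succ with h | h <;> rw [h] <;> nlinarith [sq_nonneg ((j i.succ).2 : ℝ)]
  have hlt : |((j 0).2 : ℝ)| < |((j β.succ).2 : ℝ)| := h0.trans_lt hβ
  have hgap : |((j 0).2 : ℝ)| + 1 ≤ |((j β.succ).2 : ℝ)| := by exact_mod_cast hlt
  have hsq : N ^ 2 ≤ ((j β.succ).2 : ℝ) ^ 2 - ((j 0).2 : ℝ) ^ 2 := by
    rw [← sq_abs ((j β.succ).2 : ℝ), ← sq_abs ((j 0).2 : ℝ)]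
    nlinarith [abs_nonneg ((j 0).2 : ℝ)]
  have hrest : N ^ θ ≤ ∑ i ∈ Finset.univ.erase β, |((j i.succ).2 : ℝ)| ^ θ := by
    refine rpow_le_sum_abs_rpow _ _ hθ hθ' hN ?_
    rcases hU 0 with h | h <;> rcases hU β.succ with h' | h' <;> rw [h, h'] at hres <;>
      nlinarith [sq_nonneg ((j 0).2 : ℝ), sq_nonneg ((j β.succ).2 : ℝ)]
  have := Real.rpow_le_rpow (abs_nonneg _) hlt.le hθ.le
  linarith

theorem tsum_fin_prod_eq_pow {ι : Type*} (g : ι → ENNReal) (k : ℕ) :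
    ∑' t : Fin k → ι, ∏ i, g (t i) = (∑' p, g p) ^ k := by
  induction k with
  | zero => simp
  | succ k ih =>
    rw [← (Fin.consEquiv (fun _ : Fin (k + 1) => ι)).tsum_eq, ENNReal.tsum_prod', pow_succ', ← ih,
      ← ENNReal.tsum_mul_right]
    refine tsum_congr fun p => ?_
    rw [← ENNReal.tsum_mul_left]
    refine tsum_congr fun t => ?_
    simp [Fin.consEquiv, Fin.prod_univ_succ]

/-- By the symmetry `δ ↦ -δ`, multi-indices with total sign `1` carry at most half of the mass. -/
theorem two_mul_tsum_sign_eq_one_le {k : ℕ} (g : ℤ × ℤ → ENNReal)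
    (hg : ∀ p, g (-p.1, p.2) = g p) :
    2 * ∑' t : Fin k → ℤ × ℤ, (if ∑ i, (t i).1 = 1 then ∏ i, g (t i) else 0) ≤
      (∑' p, g p) ^ k := by
  have hflip : ∑' t : Fin k → ℤ × ℤ, (if ∑ i, (t i).1 = 1 then ∏ i, g (t i) else 0) =
      ∑' t : Fin k → ℤ × ℤ, (if ∑ i, (t i).1 = -1 then ∏ i, g (t i) else 0) := by
    rw [← (Equiv.arrowCongr (Equiv.refl (Fin k))
      ((Equiv.neg ℤ).prodCongr (Equiv.refl ℤ))).tsum_eq]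
    refine tsum_congr fun t => ?_
    have hg' : ∀ p, g (Prod.map Neg.neg id p) = g p := hg
    simp [Equiv.arrowCongr, hg', neg_eq_iff_eq_neg]
  rw [← tsum_fin_prod_eq_pow, two_mul]
  nth_rw 2 [hflip]
  rw [← ENNReal.tsum_add]
  refine ENNReal.tsum_le_tsum fun t => ?_
  by_cases h : ∑ i, (t i).1 = 1
  · simp [h]
  · simp only [if_neg h, zero_add]
    split_ifs <;> simp

/-- Summing over the first entry of zero momentum multi-indices: it is fixed by the others. -/
theorem tsum_inM_le {k : ℕ} (G : (Fin k → ℤ × ℤ) → ENNReal) :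
    ∑' a : ℤ, ∑' j : Fin (k + 1) → ℤ × ℤ,
        (if inM j ∧ j 0 = (-1, a) then G (Fin.tail j) else 0) ≤
      ∑' t : Fin k → ℤ × ℤ, (if ∑ i, (t i).1 = 1 then G t else 0) := by
  have hsum : ∀ j : Fin (k + 1) → ℤ × ℤ,
      ∑' a : ℤ, (if inM j ∧ j 0 = (-1, a) then G (Fin.tail j) else 0) =
        if inM j ∧ (j 0).1 = -1 then G (Fin.tail j) else 0 := by
    intro j
    rw [tsum_eq_single (j 0).2]
    · simp [Prod.ext_iff]
    · intro a ha
      rw [if_neg]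
      rintro ⟨-, h⟩
      exact ha (by rw [h])
  rw [ENNReal.tsum_comm]
  simp_rw [hsum]
  rw [← (Fin.consEquiv (fun _ : Fin (k + 1) => ℤ × ℤ)).tsum_eq, ENNReal.tsum_prod',
    ENNReal.tsum_comm]
  refine ENNReal.tsum_le_tsum fun t => ?_
  have key : ∀ p : ℤ × ℤ, inM (Fin.cons p t : Fin (k + 1) → ℤ × ℤ) ∧ p.1 = -1 →
      p = (-1, ∑ i, (t i).1 * (t i).2) ∧ ∑ i, (t i).1 = 1 := by
    rintro ⟨d, a⟩ ⟨⟨-, h1, h2⟩, rfl⟩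
    simp only [Fin.sum_univ_succ, Fin.cons_zero, Fin.cons_succ] at h1 h2
    exact ⟨by ext <;> simp; linarith, by linarith⟩
  rw [tsum_eq_single ((-1, ∑ i, (t i).1 * (t i).2) : ℤ × ℤ)]
  · simp only [Fin.consEquiv, Equiv.coe_fn_mk, Fin.cons_zero, Fin.tail_cons]
    split_ifs with h1 h2
    · exact le_rfl
    · exact absurd (key (-1, _) ⟨h1.1, rfl⟩).2 h2
    · exact zero_le
    · exact le_rfl
  · intro p hp
    simp only [Fin.consEquiv, Equiv.coe_fn_mk, Fin.cons_zero]
    rw [if_neg]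
    exact fun h => hp (key p h).1

theorem wt_pos (σ θ : ℝ) (a : ℤ) : 0 < wt σ θ a := Real.exp_pos _

theorem norm_idxVal (z : ℤ → ℂ) (p : ℤ × ℤ) : ‖idxVal z p‖ = ‖z p.2‖ := by
  unfold idxVal
  split_ifs <;> simp

theorem supNorm_nonneg {n : ℕ} (P : (Fin n → ℤ × ℤ) → ℂ) : 0 ≤ supNorm P :=
  Real.iSup_nonneg fun _ => norm_nonneg _

/-- The weighted modulus of the entry indexed by `p`, extended by zero off `𝕌₂ × ℤ`. -/
def wtMass (σ θ : ℝ) (z : ℤ → ℂ) (p : ℤ × ℤ) : ENNReal :=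
  if p.1 = 1 ∨ p.1 = -1 then ENNReal.ofReal (wt σ θ p.2 * ‖z p.2‖) else 0

theorem wtMass_neg (σ θ : ℝ) (z : ℤ → ℂ) (p : ℤ × ℤ) :
    wtMass σ θ z (-p.1, p.2) = wtMass σ θ z p := by
  simp [wtMass, neg_eq_iff_eq_neg, or_comm]

theorem tsum_wtMass {σ θ : ℝ} {z : ℤ → ℂ} (hz : inG σ θ z) :
    ∑' p, wtMass σ θ z p = ENNReal.ofReal (gNorm σ θ z) := by
  have hnn : ∀ a, 0 ≤ wt σ θ a * ‖z a‖ := fun a => mul_nonneg (wt_pos σ θ a).le (norm_nonneg _)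
  rw [ENNReal.tsum_prod', tsum_eq_sum (s := {1, -1})]
  · rw [gNorm, ENNReal.ofReal_mul zero_le_two, ENNReal.ofReal_tsum_of_nonneg hnn hz,
      Finset.sum_pair (by decide)]
    simp [wtMass, two_mul]
  · intro d hd
    have hd' : ¬ (d = 1 ∨ d = -1) := by simpa using hd
    simp [wtMass, hd']

/-- The monomials of the vector field, weighted at the output mode. -/
theorem wt_mul_norm_monomial_le {k : ℕ} {σ θ N M : ℝ} (hσ : 0 < σ) (hθ : 0 < θ) (hθ' : θ ≤ 2)
    (hN : 0 ≤ N) (hM : 1 ≤ M) (hNM : N ^ 2 ≤ M) {K : (Fin (k + 1) → ℤ × ℤ) → ℂ} (hK : inHR K)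
    (hhigh : ∀ j, (∀ α, (brk ((j α).2) : ℝ) ≤ M) → K j = 0) (z : ℤ → ℂ)
    (j : Fin (k + 1) → ℤ × ℤ) (h0 : |((j 0).2 : ℝ)| ≤ M) :
    wt σ θ (j 0).2 * ‖K j * ∏ α ∈ Finset.univ.erase (0 : Fin (k + 1)), idxVal z (j α)‖ ≤
      supNorm K * Real.exp (-(σ * N ^ θ)) *
        ∏ i : Fin k, wt σ θ (j i.succ).2 * ‖z (j i.succ).2‖ := by
  have hS := supNorm_nonneg K
  have hprod : 0 ≤ ∏ i : Fin k, wt σ θ (j i.succ).2 * ‖z (j i.succ).2‖ :=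
    Finset.prod_nonneg fun i _ => mul_nonneg (wt_pos _ _ _).le (norm_nonneg _)
  by_cases hKj : K j = 0
  · rw [hKj, zero_mul, norm_zero, mul_zero]
    positivity
  have hexβ : ∃ β : Fin k, M < |((j β.succ).2 : ℝ)| := by
    by_contra! hcon
    refine hKj (hhigh j fun α => (brk_le_iff hM).2 ?_)
    exact Fin.cases h0 hcon α
  obtain ⟨β, hβ⟩ := hexβ
  have hadd := abs_rpow_add_le_of_inR (hK.2.2.2 j hKj) hθ hθ' hN hNM h0 β hβ
  have hwt : wt σ θ (j 0).2 ≤ Real.exp (-(σ * N ^ θ)) * ∏ i : Fin k, wt σ θ (j i.succ).2 := by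
    simp only [wt]
    rw [← Real.exp_sum, ← Real.exp_add, ← Finset.mul_sum]
    exact Real.exp_le_exp.2 (by nlinarith)
  have herase : Finset.univ.erase (0 : Fin (k + 1)) = Finset.univ.map (Fin.succEmb k) := by
    ext α
    simp [Fin.exists_succ_eq]
  have hnorm : ‖∏ α ∈ Finset.univ.erase (0 : Fin (k + 1)), idxVal z (j α)‖ =
      ∏ i : Fin k, ‖z (j i.succ).2‖ := by
    simp [herase, norm_prod, norm_idxVal]
  have hKle : ‖K j‖ ≤ supNorm K := le_ciSup hK.2.2.1 j
  rw [norm_mul, hnorm, Finset.prod_mul_distrib]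
  have hz : 0 ≤ ∏ i : Fin k, ‖z (j i.succ).2‖ := Finset.prod_nonneg fun _ _ => norm_nonneg _
  calc wt σ θ (j 0).2 * (‖K j‖ * ∏ i : Fin k, ‖z (j i.succ).2‖)
      ≤ (Real.exp (-(σ * N ^ θ)) * ∏ i : Fin k, wt σ θ (j i.succ).2) *
        (supNorm K * ∏ i : Fin k, ‖z (j i.succ).2‖) := by
        gcongr
        exact (wt_pos _ _ _).le.trans hwt
    _ = _ := by ring

/-- One low component of the vector field. -/
theorem ofReal_wt_mul_norm_XP_le {k : ℕ} {σ θ N M : ℝ} (hσ : 0 < σ) (hθ : 0 < θ) (hθ' : θ ≤ 2)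
    (hN : 0 ≤ N) (hM : 1 ≤ M) (hNM : N ^ 2 ≤ M) {K : (Fin (k + 1) → ℤ × ℤ) → ℂ} (hK : inHR K)
    (hhigh : ∀ j, (∀ α, (brk ((j α).2) : ℝ) ≤ M) → K j = 0) (z : ℤ → ℂ)
    (a : ℤ) (ha : |(a : ℝ)| ≤ M) :
    ENNReal.ofReal (wt σ θ a * ‖XP k.succ_pos K z (1, a)‖) ≤
      ENNReal.ofReal ((k + 1 : ℕ) * (supNorm K * Real.exp (-(σ * N ^ θ)))) *
        ∑' j : Fin (k + 1) → ℤ × ℤ,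
          if inM j ∧ j 0 = (-1, a) then ∏ i, wtMass σ θ z (Fin.tail j i) else 0 := by
  have hS := supNorm_nonneg K
  have hX : ‖XP k.succ_pos K z (1, a)‖ = (k + 1 : ℕ) * ‖∑' j : Fin (k + 1) → ℤ × ℤ,
      if inM j ∧ j 0 = (-1, a) then
        K j * ∏ α ∈ Finset.univ.erase (0 : Fin (k + 1)), idxVal z (j α) else 0‖ := by
    rw [XP, norm_mul]
    congr 1
    simp only [Int.cast_one, mul_one, norm_mul, Complex.norm_I, Complex.norm_natCast]
  rw [hX, mul_left_comm, ENNReal.ofReal_mul (Nat.cast_nonneg _),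
    ENNReal.ofReal_mul (Nat.cast_nonneg _), mul_assoc]
  gcongr
  rw [ENNReal.ofReal_mul (wt_pos _ _ _).le, ofReal_norm]
  refine (mul_le_mul_right enorm_tsum_le_tsum_enorm _).trans ?_
  rw [← ENNReal.tsum_mul_left, ← ENNReal.tsum_mul_left]
  refine ENNReal.tsum_le_tsum fun j => ?_
  split_ifs with h
  · obtain ⟨hj, hj0⟩ := h
    have hmass : ∏ i, wtMass σ θ z (Fin.tail j i) =
        ENNReal.ofReal (∏ i : Fin k, wt σ θ (j i.succ).2 * ‖z (j i.succ).2‖) := by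
      rw [ENNReal.ofReal_prod_of_nonneg
        fun i _ => mul_nonneg (wt_pos _ _ _).le (norm_nonneg _)]
      exact Finset.prod_congr rfl fun i _ => if_pos (hj.1 i.succ)
    have hlow := wt_mul_norm_monomial_le hσ hθ hθ' hN hM hNM hK hhigh z j (by rwa [hj0])
    rw [hj0] at hlow
    rw [hmass, ← ofReal_norm, ← ENNReal.ofReal_mul (wt_pos _ _ _).le,
      ← ENNReal.ofReal_mul (by positivity)]
    exact ENNReal.ofReal_le_ofReal hlow
  · simp

theorem gNorm_PiM_XP_le {n : ℕ} (hn : 0 < n) {σ θ N M : ℝ} (hσ : 0 < σ) (hθ : 0 < θ)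
    (hθ' : θ ≤ 2) (hN : 0 ≤ N) (hM : 1 ≤ M) (hNM : N ^ 2 ≤ M) {K : (Fin n → ℤ × ℤ) → ℂ}
    (hK : inHR K) (hhigh : ∀ j, (∀ α, (brk ((j α).2) : ℝ) ≤ M) → K j = 0) {z : ℤ → ℂ}
    (hz : inG σ θ z) :
    gNorm σ θ (PiM M (fun a => XP hn K z ((1 : ℤ), a))) ≤
      n * supNorm K * Real.exp (-(σ * N ^ θ)) * gNorm σ θ z ^ (n - 1) := by
  obtain ⟨k, rfl⟩ : ∃ k, n = k + 1 := ⟨n - 1, by omega⟩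
  have hS := supNorm_nonneg K
  have hz0 : 0 ≤ gNorm σ θ z := mul_nonneg zero_le_two
    (tsum_nonneg fun a => mul_nonneg (wt_pos _ _ _).le (norm_nonneg _))
  set u : ℤ → ℝ := fun a => wt σ θ a * ‖PiM M (fun a => XP hn K z ((1 : ℤ), a)) a‖ with hu
  have hu0 : ∀ a, 0 ≤ u a := fun a => mul_nonneg (wt_pos _ _ _).le (norm_nonneg _)
  have hgN : gNorm σ θ (PiM M (fun a => XP hn K z ((1 : ℤ), a))) =
      (2 * ∑' a, ENNReal.ofReal (u a)).toReal := by
    rw [ENNReal.toReal_mul, ENNReal.tsum_toReal_eq fun _ => ENNReal.ofReal_ne_top]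
    simp only [ENNReal.toReal_ofReal (hu0 _), ENNReal.toReal_ofNat]
    rfl
  rw [hgN]
  refine ENNReal.toReal_le_of_le_ofReal (by positivity) ?_
  set C : ℝ := (k + 1 : ℕ) * (supNorm K * Real.exp (-(σ * N ^ θ))) with hC
  have hterm : ∀ a, ENNReal.ofReal (u a) ≤ ENNReal.ofReal C * ∑' j : Fin (k + 1) → ℤ × ℤ,
      if inM j ∧ j 0 = (-1, a) then ∏ i, wtMass σ θ z (Fin.tail j i) else 0 := by
    intro a
    by_cases ha : |(a : ℝ)| ≤ M
    · simp only [hu, PiM, if_pos ha]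
      exact ofReal_wt_mul_norm_XP_le hσ hθ hθ' hN hM hNM hK hhigh z a ha
    · simp [hu, PiM, ha]
  calc 2 * ∑' a, ENNReal.ofReal (u a)
      ≤ 2 * ∑' a, (ENNReal.ofReal C * ∑' j : Fin (k + 1) → ℤ × ℤ,
          if inM j ∧ j 0 = (-1, a) then ∏ i, wtMass σ θ z (Fin.tail j i) else 0) := by
        gcongr with a
        exact hterm a
    _ ≤ 2 * (ENNReal.ofReal C * ∑' t : Fin k → ℤ × ℤ,
          if ∑ i, (t i).1 = 1 then ∏ i, wtMass σ θ z (t i) else 0) := by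
        rw [ENNReal.tsum_mul_left]
        gcongr
        exact tsum_inM_le fun t => ∏ i, wtMass σ θ z (t i)
    _ ≤ ENNReal.ofReal C * (∑' p, wtMass σ θ z p) ^ k := by
        rw [mul_left_comm]
        gcongr
        exact two_mul_tsum_sign_eq_one_le _ (wtMass_neg σ θ z)
    _ = _ := by
        rw [tsum_wtMass hz, ← ENNReal.ofReal_pow hz0, ← ENNReal.ofReal_mul (by positivity), hC,
          Nat.add_sub_cancel]
        congr 1
        ring

/-- **Statement 12.** Mismatch vector field estimate: if `K ∈ H_m^𝓡` only contains
monomials with `μ₁(𝐣) > M`, where `M = 6rN²`, then the low-mode truncation of its vector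
field is exponentially small. -/
theorem stmt12 (σ θ : ℝ) (hσ : 0 < σ) (hθ : θ ∈ Set.Ioo (0 : ℝ) 1)
    (r : ℕ) (hr : 1 ≤ r) (N : ℝ) (hN : 1 ≤ N)
    (m : ℕ) (hm : 1 ≤ m) (K : (Fin (2 * m) → ℤ × ℤ) → ℂ) (hK : inHR K)
    (hhigh : ∀ j : Fin (2 * m) → ℤ × ℤ, (∀ α, (brk ((j α).2) : ℝ) ≤ 6 * r * N ^ 2) → K j = 0)
    (z : ℤ → ℂ) (hz : inG σ θ z) :
    gNorm σ θ (PiM (6 * r * N ^ 2)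
        (fun a => XP (by omega) K z ((1 : ℤ), a))) ≤
      2 * m * supNorm K * Real.exp (-(σ * N ^ θ)) * gNorm σ θ z ^ (2 * m - 1) := by
  have hr' : (1 : ℝ) ≤ r := by exact_mod_cast hr
  have hM : N ^ 2 ≤ 6 * r * N ^ 2 := by nlinarith [sq_nonneg N]
  have h := gNorm_PiM_XP_le (by omega) hσ hθ.1 (by linarith [hθ.2]) (by linarith)
    (by nlinarith) hM hK hhigh hz
  push_cast at h
  exact h
end
end

section
/- Let ε > 0, κ ∈ (0,1), r ≥ 3, and let M ≥ L ≥ 3r be real numbers. If δ ≤ κ · ε² · (64M²)^{−1} · (9r)^{−2r} · L^{−3r} · e^{−3σr}, then Leb({z ∈ 𝔹_M(0,ε) : |ω_𝐣^L(z)| > δ for all 𝐣 ∈ 𝓝^{r,L}}) ≥ (1 − κ) · Leb(𝔹_M(0,ε)), where Leb denotes Lebesgue measure on the finite-dimensional space 𝒢_M = ℂ^{{a∈ℤ : |a|≤M}} and 𝔹_M(0,ε) := {z ∈ 𝒢_M : ‖z‖_σ < ε}. -/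
noncomputable section

attribute [local instance] Classical.propDecidable

open scoped BigOperators

open MeasureTheory

/-- The integer cut-off `⌊M⌋` corresponding to a real truncation parameter `M`:
for an integer `a`, `|a| ≤ M ↔ a ∈ [-⌊M⌋, ⌊M⌋]`. -/
def Kfl (M : ℝ) : ℤ := Int.floor M

/-- The identification of `𝒢_M = ℂ^{{a ∈ ℤ : |a| ≤ M}}` with a subspace of `ℂ^ℤ`. -/
def embed (M : ℝ) (v : ↥(Finset.Icc (-(Kfl M)) (Kfl M)) → ℂ) : ℤ → ℂ :=
  fun a => if h : a ∈ Finset.Icc (-(Kfl M)) (Kfl M) then v ⟨a, h⟩ else 0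


/-- A rational function `∑ n_b / (x - b)²` with integer data takes a value that is bounded away
from zero at some integer point of small modulus. -/
theorem exists_int_lower_bound (S : Finset ℤ) (hS : S.Nonempty) (n : ℤ → ℤ)
    (hn : ∀ b ∈ S, n b ≠ 0) (R : ℕ) (hR : S.card ≤ R) (D : ℝ) (hD : 1 ≤ D)
    (hSD : ∀ a : ℤ, 2 * |a| ≤ 3 * R → ∀ b ∈ S, |(a : ℝ) - b| ≤ D) :
    ∃ a : ℤ, 2 * |a| ≤ 3 * R ∧ a ∉ S ∧
      (D ^ (2 * R))⁻¹ ≤ |∑ b ∈ S, (n b : ℝ) * (1 / ((a : ℝ) - b) ^ 2)| := by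
  classical
  set P : Polynomial ℤ := ∑ k ∈ S, Polynomial.C (n k) *
    ∏ l ∈ S.erase k, (Polynomial.X - Polynomial.C l) ^ 2 with hP
  have hev : ∀ x : ℤ, P.eval x = ∑ k ∈ S, n k * ∏ l ∈ S.erase k, (x - l) ^ 2 := by
    intro x
    simp [hP, Polynomial.eval_finsetSum, Polynomial.eval_prod]
  have hP0 : P ≠ 0 := by
    obtain ⟨b, hb⟩ := hS
    intro h0
    have h1 := hev b
    rw [h0, Polynomial.eval_zero, Finset.sum_eq_single b] at h1
    · refine mul_ne_zero (hn b hb) ?_ h1.symm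
      refine Finset.prod_ne_zero_iff.2 fun l hl => pow_ne_zero _ (sub_ne_zero.2 ?_)
      exact (Finset.ne_of_mem_erase hl).symm
    · intro k _ hkb
      rw [Finset.prod_eq_zero (Finset.mem_erase.2 ⟨hkb.symm, hb⟩) (by simp), mul_zero]
    · exact fun h => absurd hb h
  have hdeg : P.natDegree ≤ 2 * (S.card - 1) := by
    refine Polynomial.natDegree_sum_le_of_forall_le _ _ fun k hk => ?_
    refine (Polynomial.natDegree_C_mul_le _ _).trans ?_
    refine (Polynomial.natDegree_prod_le _ _).trans ?_
    refine (Finset.sum_le_card_nsmul _ _ 2 fun l _ => ?_).trans ?_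
    · refine Polynomial.natDegree_pow_le.trans ?_
      simpa using Polynomial.natDegree_X_sub_C_le l
    · rw [Finset.card_erase_of_mem hk, smul_eq_mul, mul_comm]
  have hcard : (S ∪ P.roots.toFinset).card <
      (Finset.Icc (-((3 * R / 2 : ℕ) : ℤ)) ((3 * R / 2 : ℕ) : ℤ)).card := by
    have h1 := Finset.card_union_le S P.roots.toFinset
    have h2 := P.roots.toFinset_card_le
    have h3 := P.card_roots'
    have h4 := hS.card_pos
    rw [Int.card_Icc]
    omega
  obtain ⟨a, ha, haS⟩ := Finset.exists_mem_notMem_of_card_lt_card hcard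
  rw [Finset.mem_union, not_or, Multiset.mem_toFinset, Polynomial.mem_roots hP0] at haS
  obtain ⟨haS, har⟩ := haS
  have haR : 2 * |a| ≤ 3 * R := by
    rw [Finset.mem_Icc] at ha
    have : |a| ≤ ((3 * R / 2 : ℕ) : ℤ) := abs_le.2 ha
    omega
  refine ⟨a, haR, haS, ?_⟩
  have hne : ∀ l ∈ S, (a : ℝ) - l ≠ 0 := fun l hl h => haS (by
    have : a = l := by exact_mod_cast sub_eq_zero.1 h
    exact this ▸ hl)
  have hprod : 0 < ∏ l ∈ S, ((a : ℝ) - l) ^ 2 :=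
    Finset.prod_pos fun l hl => by have := hne l hl; positivity
  have heq : ∑ b ∈ S, (n b : ℝ) * (1 / ((a : ℝ) - b) ^ 2) =
      ((P.eval a : ℤ) : ℝ) / ∏ l ∈ S, ((a : ℝ) - l) ^ 2 := by
    rw [hev, eq_div_iff hprod.ne', Finset.sum_mul]
    push_cast
    refine Finset.sum_congr rfl fun b hb => ?_
    rw [← Finset.mul_prod_erase S _ hb]
    have := hne b hb
    field_simp
  rw [heq, abs_div, abs_of_pos hprod, inv_eq_one_div]
  have hP1 : (1 : ℝ) ≤ |((P.eval a : ℤ) : ℝ)| := by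
    exact_mod_cast Int.one_le_abs har
  have hD2 : ∏ l ∈ S, ((a : ℝ) - l) ^ 2 ≤ D ^ (2 * R) := by
    calc ∏ l ∈ S, ((a : ℝ) - l) ^ 2 ≤ ∏ l ∈ S, D ^ 2 := by
          refine Finset.prod_le_prod (fun _ _ => sq_nonneg _) fun l hl => ?_
          exact sq_le_sq' (abs_le.1 (hSD a haR l hl)).1 (abs_le.1 (hSD a haR l hl)).2
      _ = D ^ (2 * S.card) := by rw [Finset.prod_const, pow_mul]
      _ ≤ D ^ (2 * R) := pow_le_pow_right₀ hD (by omega)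
  exact div_le_div₀ (by positivity) hP1 hprod hD2

/-- A multi-index whose signs sum to zero over each mode is integrable. -/
theorem integ_of_sum_fiber_eq_zero {n : ℕ} (j : Fin n → ℤ × ℤ) (hj : isU2 j)
    (h : ∀ b : ℤ, ∑ β with (j β).2 = b, (j β).1 = 0) : integ j := by
  have key : ∀ b : ℤ, Fintype.card {α // j α = (1, b)} = Fintype.card {α // j α = (-1, b)} := by
    intro b
    have h1 := h b
    have hsum : ∑ β with (j β).2 = b, (j β).1 =
        ∑ β, ((if j β = (1, b) then (1 : ℤ) else 0) - if j β = (-1, b) then 1 else 0) := by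
      rw [Finset.sum_filter]
      refine Finset.sum_congr rfl fun β _ => ?_
      rcases hj β with h2 | h2 <;> by_cases h3 : (j β).2 = b <;> simp [Prod.ext_iff, h2, h3]
    rw [hsum, Finset.sum_sub_distrib, Finset.sum_boole, Finset.sum_boole] at h1
    rw [Fintype.card_subtype, Fintype.card_subtype]
    exact_mod_cast sub_eq_zero.1 h1
  have key2 : ∀ p : ℤ × ℤ,
      Nonempty ({α // (-(j α).1, (j α).2) = p} ≃ {α // j α = p}) := by
    rintro ⟨s, b⟩
    have hneg : ∀ α, (-(j α).1, (j α).2) = (s, b) ↔ j α = (-s, b) := by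
      intro α
      simp only [Prod.ext_iff]
      constructor <;> rintro ⟨h1, h2⟩ <;> exact ⟨by omega, h2⟩
    refine ⟨(Equiv.subtypeEquivRight hneg).trans (Fintype.equivOfCardEq ?_)⟩
    by_cases h1 : s = 1
    · subst h1; exact (key b).symm
    by_cases h2 : s = -1
    · subst h2; exact key b
    have : ∀ s' : ℤ, s' ≠ 1 → s' ≠ -1 → Fintype.card {α // j α = (s', b)} = 0 := by
      intro s' h3 h4
      rw [Fintype.card_eq_zero_iff]
      refine ⟨fun ⟨α, hα⟩ => ?_⟩
      rcases hj α with h5 | h5 <;> rw [hα] at h5 <;> contradiction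
    rw [this _ (by omega) (by omega), this _ h1 h2]
  exact ⟨Equiv.ofFiberEquiv fun p => (key2 p).some, fun α => Equiv.ofFiberEquiv_map _ α⟩

/-- The set of complex numbers with squared modulus in `[u, v]` has area at most `π (v - u)`. -/
theorem volume_sq_norm_Icc_le (u v : ℝ) :
    volume {z : ℂ | u ≤ ‖z‖ ^ 2 ∧ ‖z‖ ^ 2 ≤ v} ≤ ENNReal.ofReal (v - u) * NNReal.pi := by
  rcases lt_or_ge v (max u 0) with hv | hv
  · have : {z : ℂ | u ≤ ‖z‖ ^ 2 ∧ ‖z‖ ^ 2 ≤ v} = ∅ := by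
      ext z
      simp only [Set.mem_ofPred_eq, Set.mem_empty_iff_false, iff_false, not_and, not_le]
      intro h
      exact hv.trans_le (max_le h (sq_nonneg _))
    rw [this, measure_empty]
    exact zero_le
  have h0 : 0 ≤ max u 0 := le_max_right _ _
  have hsub : {z : ℂ | u ≤ ‖z‖ ^ 2 ∧ ‖z‖ ^ 2 ≤ v} ⊆
      Metric.closedBall 0 (√v) \ Metric.ball 0 (√(max u 0)) := by
    rintro z ⟨h1, h2⟩
    rw [Set.mem_sdiff, mem_closedBall_zero_iff, mem_ball_zero_iff, not_lt]
    exact ⟨Real.le_sqrt_of_sq_le h2,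
      Real.sqrt_le_iff.2 ⟨norm_nonneg _, max_le h1 (sq_nonneg _)⟩⟩
  refine (measure_mono hsub).trans ?_
  rw [measure_sdiff (Metric.ball_subset_closedBall.trans
      (Metric.closedBall_subset_closedBall (Real.sqrt_le_sqrt hv)))
      measurableSet_ball.nullMeasurableSet measure_ball_lt_top.ne,
    Complex.volume_closedBall, Complex.volume_ball,
    ← ENNReal.ofReal_pow (Real.sqrt_nonneg _), ← ENNReal.ofReal_pow (Real.sqrt_nonneg _),
    Real.sq_sqrt h0, Real.sq_sqrt (h0.trans hv),
    ← ENNReal.sub_mul (fun _ _ => ENNReal.coe_ne_top), ← ENNReal.ofReal_sub _ h0]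
  gcongr
  exact le_max_left _ _

/-- Compare the measure of a slab `{|∑ c_i |v_i|²| ≤ δ}` of a weighted `ℓ¹` ball with the measure
of a cylinder whose base is the corresponding ball in the remaining coordinates. -/
theorem volume_slab_le_cylinder {ι : Type*} [Fintype ι] [DecidableEq ι] (w c : ι → ℝ)
    (hw : ∀ i, 0 < w i) (ε δ ρ : ℝ) (i₀ : ι) (hc : 0 < |c i₀|) (hδ : 0 ≤ δ) (hρ : 0 < ρ) :
    volume {v : ι → ℂ | ∑ i, w i * ‖v i‖ < ε ∧ |∑ i, c i * ‖v i‖ ^ 2| ≤ δ} ≤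
      ENNReal.ofReal (2 * δ / (|c i₀| * ρ ^ 2)) *
        volume {v : ι → ℂ | ∑ i ∈ Finset.univ.erase i₀, w i * ‖v i‖ < ε ∧ ‖v i₀‖ < ρ} := by
  set A := {v : ι → ℂ | ∑ i, w i * ‖v i‖ < ε ∧ |∑ i, c i * ‖v i‖ ^ 2| ≤ δ} with hA
  set C := {v : ι → ℂ | ∑ i ∈ Finset.univ.erase i₀, w i * ‖v i‖ < ε ∧ ‖v i₀‖ < ρ} with hC
  have hAm : MeasurableSet A := by
    have h1 : Measurable fun v : ι → ℂ => ∑ i, w i * ‖v i‖ := by fun_prop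
    have h2 : Measurable fun v : ι → ℂ => |∑ i, c i * ‖v i‖ ^ 2| := by fun_prop
    exact (measurableSet_lt h1 measurable_const).inter (measurableSet_le h2 measurable_const)
  have hCm : MeasurableSet C := by
    have h1 : Measurable fun v : ι → ℂ => ∑ i ∈ Finset.univ.erase i₀, w i * ‖v i‖ := by fun_prop
    have h2 : Measurable fun v : ι → ℂ => ‖v i₀‖ := by fun_prop
    exact (measurableSet_lt h1 measurable_const).inter (measurableSet_lt h2 measurable_const)
  set q := ENNReal.ofReal (2 * δ / (|c i₀| * ρ ^ 2)) with hq
  rw [← lintegral_indicator_one hAm, ← lintegral_indicator_one hCm,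
    ← lintegral_const_mul _ (measurable_one.indicator hCm)]
  refine lintegral_le_of_lmarginal_le {i₀} (measurable_one.indicator hAm)
    ((measurable_one.indicator hCm).const_mul _) ?_
  rw [lmarginal_singleton, lmarginal_singleton]
  intro x
  have hsum : ∀ (f : ι → ℂ → ℝ) (z : ℂ), ∑ i, f i (Function.update x i₀ z i) =
      f i₀ z + ∑ i ∈ Finset.univ.erase i₀, f i (x i) := by
    intro f z
    rw [← Finset.add_sum_erase _ _ (Finset.mem_univ i₀), Function.update_self]
    congr 1
    refine Finset.sum_congr rfl fun i hi => ?_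
    rw [Function.update_of_ne (Finset.ne_of_mem_erase hi)]
  have herase : ∀ z : ℂ, ∑ i ∈ Finset.univ.erase i₀, w i * ‖Function.update x i₀ z i‖ =
      ∑ i ∈ Finset.univ.erase i₀, w i * ‖x i‖ := fun z =>
    Finset.sum_congr rfl fun i hi => by
      rw [Function.update_of_ne (Finset.ne_of_mem_erase hi)]
  have hAf : ∀ z : ℂ, A.indicator (1 : (ι → ℂ) → ENNReal) (Function.update x i₀ z) =
      {z : ℂ | Function.update x i₀ z ∈ A}.indicator 1 z := fun z => rfl
  have hCf : ∀ z : ℂ, C.indicator (1 : (ι → ℂ) → ENNReal) (Function.update x i₀ z) =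
      {z : ℂ | Function.update x i₀ z ∈ C}.indicator 1 z := fun z => rfl
  have hum : Measurable fun z : ℂ => Function.update x i₀ z := measurable_update x
  have hAx : MeasurableSet {z : ℂ | Function.update x i₀ z ∈ A} := hum hAm
  have hCx : MeasurableSet {z : ℂ | Function.update x i₀ z ∈ C} := hum hCm
  simp_rw [hAf, hCf]
  rw [lintegral_const_mul _ (measurable_one.indicator hCx),
    lintegral_indicator_one hAx, lintegral_indicator_one hCx]
  by_cases hx : ∑ i ∈ Finset.univ.erase i₀, w i * ‖x i‖ < ε
  · have hCeq : {z : ℂ | Function.update x i₀ z ∈ C} = Metric.ball 0 ρ := by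
      ext z
      simp only [hC, Set.mem_ofPred_eq, herase, Function.update_self, mem_ball_zero_iff, hx,
        true_and]
    set T := ∑ i ∈ Finset.univ.erase i₀, c i * ‖x i‖ ^ 2 with hT
    have hAsub : {z : ℂ | Function.update x i₀ z ∈ A} ⊆
        {z : ℂ | -T / c i₀ - δ / |c i₀| ≤ ‖z‖ ^ 2 ∧ ‖z‖ ^ 2 ≤ -T / c i₀ + δ / |c i₀|} := by
      intro z hz
      have h2 := hz.2
      rw [hsum (fun i z => c i * ‖z‖ ^ 2) z, ← hT] at h2
      have h3 : |‖z‖ ^ 2 - -T / c i₀| ≤ δ / |c i₀| := by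
        rw [le_div_iff₀ hc, ← abs_mul]
        have hc0 : c i₀ ≠ 0 := abs_pos.1 hc
        have h4 : (‖z‖ ^ 2 - -T / c i₀) * c i₀ = c i₀ * ‖z‖ ^ 2 + T := by
          field_simp
          ring
        rwa [h4]
      have h4 := abs_le.1 h3
      exact ⟨by linarith [h4.1], by linarith [h4.2]⟩
    refine (measure_mono hAsub).trans ((volume_sq_norm_Icc_le _ _).trans ?_)
    rw [hCeq, Complex.volume_ball, ← mul_assoc, hq, ← ENNReal.ofReal_pow hρ.le,
      ← ENNReal.ofReal_mul (by positivity)]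
    refine le_of_eq ?_
    congr 2
    field_simp
    ring
  · have : {z : ℂ | Function.update x i₀ z ∈ A} = ∅ := by
      ext z
      simp only [hA, Set.mem_ofPred_eq, Set.mem_empty_iff_false, iff_false, not_and]
      intro h
      rw [hsum (fun i z => w i * ‖z‖) z] at h
      have : 0 ≤ w i₀ * ‖z‖ := mul_nonneg (hw i₀).le (norm_nonneg _)
      exact absurd (by linarith) hx
    rw [this, measure_empty]
    exact zero_le

open scoped Pointwise in
/-- A thin cylinder over a weighted `ℓ¹` ball has measure comparable to that of the ball. -/
theorem volume_cylinder_le_ball {ι : Type*} [Fintype ι] [DecidableEq ι] (w : ι → ℝ)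
    (ε t : ℝ) (hε : 0 < ε) (ht : 0 < t) (ht2 : 4 * Fintype.card ι * t ≤ 1) (ht1 : t < 1)
    (i₀ : ι) (hw : 0 < w i₀) :
    volume {v : ι → ℂ | ∑ i ∈ Finset.univ.erase i₀, w i * ‖v i‖ < ε ∧ ‖v i₀‖ < t * ε / w i₀} ≤
      2 * volume {v : ι → ℂ | ∑ i, w i * ‖v i‖ < ε} := by
  set C := {v : ι → ℂ | ∑ i ∈ Finset.univ.erase i₀, w i * ‖v i‖ < ε ∧ ‖v i₀‖ < t * ε / w i₀}
    with hC
  have hs : 0 < 1 - t := by linarith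
  have hsub : (1 - t) • C ⊆ {v : ι → ℂ | ∑ i, w i * ‖v i‖ < ε} := by
    rintro _ ⟨v, ⟨h1, h2⟩, rfl⟩
    have h3 : ∀ i, w i * ‖((1 - t) • v) i‖ = (1 - t) * (w i * ‖v i‖) := by
      intro i
      rw [Pi.smul_apply, norm_smul, Real.norm_of_nonneg hs.le]
      ring
    simp only [Set.mem_ofPred_eq, h3]
    rw [← Finset.mul_sum, ← Finset.add_sum_erase _ _ (Finset.mem_univ i₀)]
    rw [lt_div_iff₀ hw] at h2
    have : (1 - t) * (w i₀ * ‖v i₀‖ + ∑ i ∈ Finset.univ.erase i₀, w i * ‖v i‖) <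
        (1 - t) * (t * ε + ε) := mul_lt_mul_of_pos_left (by linarith) hs
    nlinarith [mul_pos (mul_pos ht ht) hε]
  have hmeas := measure_mono (μ := volume) hsub
  have hfin : Module.finrank ℝ (ι → ℂ) = 2 * Fintype.card ι := by
    rw [Module.finrank_pi_fintype]
    simp [Complex.finrank_real_complex, mul_comm]
  rw [Measure.addHaar_smul_of_nonneg _ hs.le, hfin] at hmeas
  have hb : 1 / 2 ≤ (1 - t) ^ (2 * Fintype.card ι) := by
    have := one_add_mul_le_pow (a := -t) (by linarith) (2 * Fintype.card ι)
    push_cast at this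
    rw [← sub_eq_add_neg] at this
    linarith
  calc volume C = 2 * (ENNReal.ofReal (1 / 2) * volume C) := by
        rw [← mul_assoc, show (2 : ENNReal) = ENNReal.ofReal 2 by simp,
          ← ENNReal.ofReal_mul (by norm_num)]
        norm_num
    _ ≤ 2 * (ENNReal.ofReal ((1 - t) ^ (2 * Fintype.card ι)) * volume C) := by gcongr
    _ ≤ _ := by gcongr

/-- The coefficient of `|z_a|²` in the modulated frequency `ω_𝐣^L(z)`. -/
def omegaCoeff (L : ℝ) {n : ℕ} (j : Fin n → ℤ × ℤ) (a : ℤ) : ℝ :=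
  if |(a : ℝ)| ≤ L then
    ∑ β, ((j β).1 : ℝ) * if a ≠ (j β).2 then 1 / ((a : ℝ) - ((j β).2 : ℝ)) ^ 2 else 0
  else 0

theorem embed_apply_coe (M : ℝ) (v : ↥(Finset.Icc (-(Kfl M)) (Kfl M)) → ℂ)
    (i : ↥(Finset.Icc (-(Kfl M)) (Kfl M))) : embed M v i = v i := by
  rw [embed, dif_pos i.2]

/-- A sum over `ℤ` whose terms vanish off the support of `embed M v` is a finite sum. -/
theorem tsum_embed (M : ℝ) (v : ↥(Finset.Icc (-(Kfl M)) (Kfl M)) → ℂ) (f : ℤ → ℂ → ℝ)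
    (hf : ∀ a, f a 0 = 0) :
    ∑' a : ℤ, f a (embed M v a) = ∑ i : ↥(Finset.Icc (-(Kfl M)) (Kfl M)), f i (v i) := by
  rw [tsum_eq_sum (s := Finset.Icc (-(Kfl M)) (Kfl M)), ← Finset.sum_coe_sort]
  · exact Finset.sum_congr rfl fun i _ => by rw [embed_apply_coe]
  · intro a ha
    rw [embed, dif_neg ha, hf]

theorem gNorm_embed (σ θ M : ℝ) (v : ↥(Finset.Icc (-(Kfl M)) (Kfl M)) → ℂ) :
    gNorm σ θ (embed M v) = ∑ i : ↥(Finset.Icc (-(Kfl M)) (Kfl M)), 2 * wt σ θ i * ‖v i‖ := by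
  rw [gNorm, tsum_embed M v (fun a z => wt σ θ a * ‖z‖) (by simp), Finset.mul_sum]
  simp_rw [mul_assoc]

theorem omegaM_embed (L M : ℝ) {n : ℕ} (j : Fin n → ℤ × ℤ)
    (v : ↥(Finset.Icc (-(Kfl M)) (Kfl M)) → ℂ) :
    omegaM L j (embed M v) =
      ∑ i : ↥(Finset.Icc (-(Kfl M)) (Kfl M)), omegaCoeff L j i * ‖v i‖ ^ 2 := by
  have h : ∀ β, (∑' a : ℤ, if a ≠ (j β).2 ∧ |(a : ℝ)| ≤ L then
      ‖embed M v a‖ ^ 2 / ((a : ℝ) - ((j β).2 : ℝ)) ^ 2 else 0) =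
      ∑ i : ↥(Finset.Icc (-(Kfl M)) (Kfl M)), if (i : ℤ) ≠ (j β).2 ∧ |((i : ℤ) : ℝ)| ≤ L then
      ‖v i‖ ^ 2 / (((i : ℤ) : ℝ) - ((j β).2 : ℝ)) ^ 2 else 0 := fun β =>
    tsum_embed M v (fun a z => if a ≠ (j β).2 ∧ |(a : ℝ)| ≤ L then
      ‖z‖ ^ 2 / ((a : ℝ) - ((j β).2 : ℝ)) ^ 2 else 0) (by simp)
  simp_rw [omegaM, h, Finset.mul_sum]
  rw [Finset.sum_comm]
  refine Finset.sum_congr rfl fun i _ => ?_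
  unfold omegaCoeff
  by_cases hi : |((i : ℤ) : ℝ)| ≤ L
  · rw [if_pos hi, Finset.sum_mul]
    refine Finset.sum_congr rfl fun β _ => ?_
    by_cases h2 : (i : ℤ) = (j β).2
    · simp [h2]
    · rw [if_pos ⟨h2, hi⟩, if_pos h2]
      ring
  · simp [hi]

/-- Some low mode enters the modulated frequency of a non-integrable multi-index with a
coefficient bounded away from zero. -/
theorem exists_omegaCoeff_lower_bound {n : ℕ} (j : Fin n → ℤ × ℤ) (hj : isU2 j)
    (hni : ¬ integ j) (r : ℕ) (hn : n ≤ r) (L : ℝ) (hr : 1 ≤ r) (hrL : 3 * (r : ℝ) ≤ L)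
    (hjL : ∀ β, |((j β).2 : ℝ)| ≤ L) :
    ∃ a : ℤ, 2 * |a| ≤ 3 * r ∧ ((3 / 2 * L) ^ (2 * r))⁻¹ ≤ |omegaCoeff L j a| := by
  have hr1 : (1 : ℝ) ≤ r := by exact_mod_cast hr
  set m : ℤ → ℤ := fun b => ∑ β with (j β).2 = b, (j β).1 with hm
  set S := (Finset.univ.image fun β => (j β).2).filter fun b => m b ≠ 0 with hS
  have hSne : S.Nonempty := by
    by_contra hemp
    refine hni (integ_of_sum_fiber_eq_zero j hj fun b => ?_)
    by_contra hb
    refine hemp ⟨b, Finset.mem_filter.2 ⟨?_, hb⟩⟩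
    obtain ⟨β, hβ, -⟩ := Finset.exists_ne_zero_of_sum_ne_zero hb
    exact Finset.mem_image.2 ⟨β, Finset.mem_univ _, (Finset.mem_filter.1 hβ).2⟩
  have hcard : S.card ≤ r := by
    refine (Finset.card_filter_le _ _).trans (Finset.card_image_le.trans ?_)
    simpa using hn
  have habs : ∀ a : ℤ, 2 * |a| ≤ 3 * r → |(a : ℝ)| ≤ L / 2 := by
    intro a ha
    have : 2 * |(a : ℝ)| ≤ 3 * r := by exact_mod_cast ha
    linarith
  obtain ⟨a, ha, haS, hle⟩ := exists_int_lower_bound S hSne m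
    (fun b hb => (Finset.mem_filter.1 hb).2) r hcard (3 / 2 * L) (by linarith) (by
      intro a ha b hb
      obtain ⟨β, -, rfl⟩ := Finset.mem_image.1 (Finset.mem_filter.1 hb).1
      have h1 := habs a ha
      have h2 := abs_sub (a : ℝ) ((j β).2 : ℝ)
      linarith [hjL β])
  refine ⟨a, ha, hle.trans_eq ?_⟩
  have hmaps : ∀ β ∈ (Finset.univ : Finset (Fin n)),
      (j β).2 ∈ Finset.univ.image fun β => (j β).2 :=
    fun β hβ => Finset.mem_image_of_mem _ hβ
  have haL : |(a : ℝ)| ≤ L := by linarith [habs a ha]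
  rw [omegaCoeff, if_pos haL, ← Finset.sum_fiberwise_of_maps_to hmaps]
  have hfib : ∀ b ∈ Finset.univ.image fun β => (j β).2,
      ∑ β with (j β).2 = b, ((j β).1 : ℝ) *
        (if a ≠ (j β).2 then 1 / ((a : ℝ) - ((j β).2 : ℝ)) ^ 2 else 0) =
      (m b : ℝ) * (if a ≠ b then 1 / ((a : ℝ) - (b : ℝ)) ^ 2 else 0) := by
    intro b _
    rw [hm]
    push_cast
    rw [Finset.sum_mul]
    refine Finset.sum_congr rfl fun β hβ => ?_
    rw [(Finset.mem_filter.1 hβ).2]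
  rw [Finset.sum_congr rfl hfib]
  congr 1
  rw [← Finset.sum_filter_of_ne (s := Finset.univ.image fun β => (j β).2)
    (p := fun b => m b ≠ 0)]
  · refine Finset.sum_congr rfl fun b hb => ?_
    rw [if_pos fun h : a = b => haS (h ▸ hb)]
  · intro b _ h h0
    exact h (by simp [h0])

/-- The part of a weighted `ℓ¹` ball on which `|∑ c_i |v_i|²| ≤ δ` is a small proportion of it. -/
theorem volume_slab_le_ball {ι : Type*} [Fintype ι] (w c : ι → ℝ)
    (hw : ∀ i, 0 < w i) (ε δ γ W N : ℝ) (i₀ : ι) (hε : 0 < ε) (hδ : 0 ≤ δ) (hγ : 0 < γ)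
    (hc : γ ≤ |c i₀|) (hW : w i₀ ≤ W) (hN : Fintype.card ι ≤ N) :
    volume {v : ι → ℂ | ∑ i, w i * ‖v i‖ < ε ∧ |∑ i, c i * ‖v i‖ ^ 2| ≤ δ} ≤
      ENNReal.ofReal (64 * N ^ 2 * W ^ 2 * δ / (γ * ε ^ 2)) *
        volume {v : ι → ℂ | ∑ i, w i * ‖v i‖ < ε} := by
  classical
  have hcard : (1 : ℝ) ≤ Fintype.card ι := by
    exact_mod_cast Fintype.card_pos_iff.2 ⟨i₀⟩
  have hN1 : 1 ≤ N := hcard.trans hN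
  have hW0 : 0 < W := (hw i₀).trans_le hW
  set t : ℝ := 1 / (4 * N) with ht
  have ht0 : 0 < t := by positivity
  have htN : 4 * N * t = 1 := by rw [ht]; field_simp
  have ht2 : 4 * Fintype.card ι * t ≤ 1 := by rw [← htN]; gcongr
  have ht1 : t < 1 := by nlinarith
  have hwi := hw i₀
  refine (volume_slab_le_cylinder w c hw ε δ (t * ε / w i₀) i₀ (hγ.trans_le hc) hδ
    (by positivity)).trans ?_
  refine (mul_le_mul_right (volume_cylinder_le_ball w ε t hε ht0 ht2 ht1 i₀ hwi) _).trans ?_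
  rw [← mul_assoc, show (2 : ENNReal) = ENNReal.ofReal 2 by simp,
    ← ENNReal.ofReal_mul (by positivity)]
  gcongr
  have h1 : 2 * δ / (|c i₀| * (t * ε / w i₀) ^ 2) ≤ 2 * δ / (γ * (t * ε / W) ^ 2) := by gcongr
  refine (mul_le_mul_of_nonneg_right h1 zero_le_two).trans_eq ?_
  rw [ht]
  field_simp
  ring

/-- The multi-indices with at most `r` entries, signs in `{-1, 1}` and modes of modulus at
most `K`. -/
def boundedIndices (r : ℕ) (K : ℤ) : Finset (Σ m : ℕ, (Fin (2 * m) → ℤ × ℤ)) :=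
  (Finset.Icc 1 (r / 2)).sigma fun _ =>
    Fintype.piFinset fun _ => ({1, -1} : Finset ℤ) ×ˢ Finset.Icc (-K) K

theorem card_boundedIndices_le (r : ℕ) (L : ℝ) (hL : 2 ≤ L) :
    ((boundedIndices r ⌊L⌋).card : ℝ) ≤ r * (5 * L) ^ r := by
  have hK : 0 ≤ ⌊L⌋ := Int.floor_nonneg.2 (by linarith)
  have hc : ((({1, -1} : Finset ℤ) ×ˢ Finset.Icc (-⌊L⌋) ⌊L⌋).card : ℝ) ≤ 5 * L := by
    rw [Finset.card_product, Int.card_Icc]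
    have h1 : (({1, -1} : Finset ℤ)).card = 2 := by decide
    have h2 : (((⌊L⌋ + 1 - -⌊L⌋).toNat : ℤ) : ℝ) = 2 * (⌊L⌋ : ℝ) + 1 := by
      rw [Int.toNat_of_nonneg (by omega)]
      push_cast
      ring
    rw [Int.cast_natCast] at h2
    rw [h1, Nat.cast_mul, h2]
    push_cast
    linarith [Int.floor_le L]
  rw [boundedIndices, Finset.card_sigma]
  push_cast
  refine (Finset.sum_le_card_nsmul _ _ ((5 * L) ^ r) fun m hm => ?_).trans ?_
  · rw [Fintype.card_piFinset, Finset.prod_const, Finset.card_univ, Fintype.card_fin]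
    push_cast
    have hm2 := (Finset.mem_Icc.1 hm).2
    exact (pow_le_pow_left₀ (by positivity) hc _).trans
      (pow_le_pow_right₀ (by linarith) (by omega))
  · rw [nsmul_eq_mul, Nat.card_Icc]
    have : ((r / 2 + 1 - 1 : ℕ) : ℝ) ≤ r := by exact_mod_cast (by omega)
    have hL0 : 0 ≤ 5 * L := by linarith
    gcongr

theorem wt_le (σ θ : ℝ) (hσ : 0 < σ) (hθ : θ ∈ Set.Ioo (0 : ℝ) 1) (a : ℤ) (r : ℝ)
    (ha : 2 * |(a : ℝ)| ≤ 3 * r) : wt σ θ a ^ 2 ≤ Real.exp (3 * σ * r) := by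
  have hpow : |(a : ℝ)| ^ θ ≤ |(a : ℝ)| := by
    rcases eq_or_ne a 0 with rfl | h0
    · simp [Real.zero_rpow hθ.1.ne']
    · have h1 : (1 : ℝ) ≤ |(a : ℝ)| := by exact_mod_cast Int.one_le_abs h0
      exact (Real.rpow_le_rpow_of_exponent_le h1 hθ.2.le).trans_eq (Real.rpow_one _)
  rw [wt, ← Real.exp_nat_mul, Real.exp_le_exp]
  push_cast
  nlinarith

/-- The numerical inequality behind the union bound. -/
theorem union_bound_le (ε κ M L E : ℝ) (hε : 0 < ε) (hκ : 0 < κ) (r : ℕ) (hr : 3 ≤ r)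
    (hM : 0 < M) (hL : 0 < L) (hE : 0 < E) :
    r * (5 * L) ^ r * (64 * (3 * M) ^ 2 * (4 * E) *
      (κ * ε ^ 2 * (64 * M ^ 2)⁻¹ * ((9 * (r : ℝ)) ^ (2 * r))⁻¹ * (L ^ (3 * r))⁻¹ * E⁻¹) /
        (((3 / 2 * L) ^ (2 * r))⁻¹ * ε ^ 2)) ≤ κ := by
  have hr0 : (1 : ℝ) ≤ r := by exact_mod_cast (by omega : 1 ≤ r)
  have h1 : r * (5 * L) ^ r * (64 * (3 * M) ^ 2 * (4 * E) *
      (κ * ε ^ 2 * (64 * M ^ 2)⁻¹ * ((9 * (r : ℝ)) ^ (2 * r))⁻¹ * (L ^ (3 * r))⁻¹ * E⁻¹) /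
        (((3 / 2 * L) ^ (2 * r))⁻¹ * ε ^ 2)) =
      κ * (r * 36 * (5 ^ r * (3 / 2) ^ (2 * r)) / (9 * (r : ℝ)) ^ (2 * r)) := by
    rw [mul_pow (3 / 2 : ℝ) L, mul_pow (5 : ℝ) L, show 3 * r = r + 2 * r by ring, pow_add L]
    field_simp
    ring
  rw [h1]
  refine mul_le_of_le_one_right hκ.le (div_le_one_of_le₀ ?_ (by positivity))
  have h36 : (36 : ℝ) ≤ 4 ^ r :=
    (by norm_num : (36 : ℝ) ≤ 4 ^ 3).trans (pow_le_pow_right₀ (by norm_num) hr)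
  have hrr : (r : ℝ) ≤ (r : ℝ) ^ (2 * r) := le_self_pow₀ hr0 (by omega)
  calc (r : ℝ) * 36 * (5 ^ r * (3 / 2) ^ (2 * r))
      ≤ (r : ℝ) ^ (2 * r) * 4 ^ r * (5 ^ r * (3 / 2) ^ (2 * r)) := by gcongr
    _ = (r : ℝ) ^ (2 * r) * 45 ^ r := by
        rw [pow_mul (3 / 2 : ℝ), ← mul_pow, mul_assoc, ← mul_pow]
        norm_num
    _ ≤ (r : ℝ) ^ (2 * r) * 81 ^ r := by gcongr; norm_num
    _ = (9 * (r : ℝ)) ^ (2 * r) := by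
        rw [mul_pow, pow_mul (9 : ℝ), mul_comm]
        norm_num

/-- Passing from the measure of a bad set to that of its complement in a set of finite measure. -/
theorem ofReal_one_sub_mul_le {α : Type*} [MeasurableSpace α] (μ : Measure α) (κ : ℝ)
    (hκ0 : 0 ≤ κ) (hκ1 : κ ≤ 1) {A G B : Set α} (hA : μ A ≠ ⊤) (hAGB : A ⊆ G ∪ B)
    (hB : μ B ≤ ENNReal.ofReal κ * μ A) : ENNReal.ofReal (1 - κ) * μ A ≤ μ G := by
  have hfin : ENNReal.ofReal κ * μ A ≠ ⊤ := ENNReal.mul_ne_top ENNReal.ofReal_ne_top hA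
  refine (ENNReal.add_le_add_iff_right hfin).1 ?_
  rw [← add_mul, ← ENNReal.ofReal_add (by linarith) hκ0, sub_add_cancel, ENNReal.ofReal_one,
    one_mul]
  calc μ A ≤ μ (G ∪ B) := measure_mono hAGB
    _ ≤ μ G + μ B := measure_union_le _ _
    _ ≤ _ := by gcongr

theorem volume_gNorm_ball_ne_top (σ θ ε M : ℝ) (hσ : 0 < σ) :
    volume {v : ↥(Finset.Icc (-(Kfl M)) (Kfl M)) → ℂ | gNorm σ θ (embed M v) < ε} ≠ ⊤ := by
  have hsub : {v : ↥(Finset.Icc (-(Kfl M)) (Kfl M)) → ℂ | gNorm σ θ (embed M v) < ε} ⊆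
      Set.pi Set.univ fun _ => Metric.ball (0 : ℂ) ε := by
    intro v hv i _
    have hv' : gNorm σ θ (embed M v) < ε := hv
    rw [gNorm_embed] at hv'
    rw [mem_ball_zero_iff]
    refine lt_of_le_of_lt ?_ hv'
    have h1 : 1 ≤ wt σ θ i := Real.one_le_exp (by positivity)
    calc ‖v i‖ ≤ 2 * wt σ θ i * ‖v i‖ := le_mul_of_one_le_left (norm_nonneg _) (by linarith)
      _ ≤ _ := Finset.single_le_sum
        (f := fun i : ↥(Finset.Icc (-(Kfl M)) (Kfl M)) => 2 * wt σ θ i * ‖v i‖)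
        (fun k _ => by unfold wt; positivity) (Finset.mem_univ i)
  refine ((measure_mono hsub).trans_lt ?_).ne
  rw [volume_pi_pi]
  exact ENNReal.prod_lt_top fun _ _ => measure_ball_lt_top

/-- **Statement 13.** Quantitative measure estimate for the non-resonant set: if
`δ ≤ κ ε² (64M²)⁻¹ (9r)^{-2r} L^{-3r} e^{-3σr}` then the set of `z ∈ 𝔹_M(0,ε)` such that
`|ω_𝐣^L(z)| > δ` for all `𝐣 ∈ 𝓝^{r,L}` has measure at least `(1-κ) Leb(𝔹_M(0,ε))`. -/
theorem stmt13 (σ θ : ℝ) (hσ : 0 < σ) (hθ : θ ∈ Set.Ioo (0 : ℝ) 1)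
    (ε κ : ℝ) (hε : 0 < ε) (hκ : κ ∈ Set.Ioo (0 : ℝ) 1)
    (r : ℕ) (hr : 3 ≤ r) (M L : ℝ) (hLM : L ≤ M) (hrL : 3 * (r : ℝ) ≤ L)
    (δ : ℝ)
    (hδ : δ ≤ κ * ε ^ 2 * (64 * M ^ 2)⁻¹ * ((9 * (r : ℝ)) ^ (2 * r))⁻¹ *
      (L ^ (3 * r))⁻¹ * Real.exp (-(3 * σ * (r : ℝ)))) :
    ENNReal.ofReal (1 - κ) *
        volume {v : ↥(Finset.Icc (-(Kfl M)) (Kfl M)) → ℂ | gNorm σ θ (embed M v) < ε} ≤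
      volume {v : ↥(Finset.Icc (-(Kfl M)) (Kfl M)) → ℂ |
        gNorm σ θ (embed M v) < ε ∧ inV δ (r : ℝ) L (embed M v)} := by
  have hr' : (3 : ℝ) ≤ r := by exact_mod_cast hr
  have hL9 : 9 ≤ L := by linarith
  have hM9 : 9 ≤ M := by linarith
  set δ₀ := κ * ε ^ 2 * (64 * M ^ 2)⁻¹ * ((9 * (r : ℝ)) ^ (2 * r))⁻¹ *
      (L ^ (3 * r))⁻¹ * Real.exp (-(3 * σ * (r : ℝ))) with hδ₀
  have hκ0 := hκ.1
  have hδ₀0 : 0 ≤ δ₀ := by positivity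
  set γ := ((3 / 2 * L) ^ (2 * r))⁻¹ with hγ
  set q := 64 * (3 * M) ^ 2 * (4 * Real.exp (3 * σ * r)) * δ₀ / (γ * ε ^ 2) with hq
  set A := {v : ↥(Finset.Icc (-(Kfl M)) (Kfl M)) → ℂ | gNorm σ θ (embed M v) < ε} with hA
  set slab : (Σ m : ℕ, (Fin (2 * m) → ℤ × ℤ)) →
      Set (↥(Finset.Icc (-(Kfl M)) (Kfl M)) → ℂ) := fun p =>
    {v | gNorm σ θ (embed M v) < ε ∧ |omegaM L p.2 (embed M v)| ≤ δ₀} with hslab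
  set J := (boundedIndices r ⌊L⌋).filter fun p => ¬ integ p.2 with hJ
  have hcardM : ((Fintype.card ↥(Finset.Icc (-(Kfl M)) (Kfl M)) : ℕ) : ℝ) ≤ 3 * M := by
    have hK : 0 ≤ Kfl M := Int.floor_nonneg.2 (by linarith)
    have hKM : (Kfl M : ℝ) ≤ M := Int.floor_le M
    rw [Fintype.card_coe, Int.card_Icc]
    have h2 : (((Kfl M + 1 - -Kfl M).toNat : ℤ) : ℝ) = 2 * (Kfl M : ℝ) + 1 := by
      rw [Int.toNat_of_nonneg (by omega)]
      push_cast
      ring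
    rw [Int.cast_natCast] at h2
    rw [h2]
    linarith
  have hslab_le : ∀ p ∈ J, volume (slab p) ≤ ENNReal.ofReal q * volume A := by
    rintro ⟨m, j⟩ hp
    obtain ⟨hp, hni⟩ := Finset.mem_filter.1 hp
    obtain ⟨hm, hj⟩ := Finset.mem_sigma.1 hp
    have hj' : ∀ β, ((j β).1 = 1 ∨ (j β).1 = -1) ∧ -⌊L⌋ ≤ (j β).2 ∧ (j β).2 ≤ ⌊L⌋ := by
      intro β
      simpa using Finset.mem_product.1 (Fintype.mem_piFinset.1 hj β)
    have hm2 : m ≤ r / 2 := (Finset.mem_Icc.1 hm).2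
    obtain ⟨a, ha, hac⟩ := exists_omegaCoeff_lower_bound j (fun β => (hj' β).1) hni r
      (by omega) L (by omega) hrL (fun β => by
        have h1 : ((|(j β).2| : ℤ) : ℝ) ≤ (⌊L⌋ : ℤ) := by
          exact_mod_cast abs_le.2 (hj' β).2
        rw [Int.cast_abs] at h1
        exact h1.trans (Int.floor_le L))
    have haR : 2 * |(a : ℝ)| ≤ 3 * r := by exact_mod_cast ha
    have haK : a ∈ Finset.Icc (-(Kfl M)) (Kfl M) := by
      rw [Finset.mem_Icc, ← abs_le]
      refine Int.le_floor.2 ?_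
      push_cast
      linarith
    have hwt := wt_le σ θ hσ hθ a r haR
    have hW : 2 * wt σ θ a ≤ 2 * √(Real.exp (3 * σ * r)) := by
      have := Real.le_sqrt_of_sq_le hwt
      linarith
    have hmain := volume_slab_le_ball
      (fun i : ↥(Finset.Icc (-(Kfl M)) (Kfl M)) => 2 * wt σ θ i) (fun i => omegaCoeff L j i)
      (fun i => by unfold wt; positivity) ε δ₀ γ _ (3 * M) ⟨a, haK⟩ hε hδ₀0
      (by positivity) hac hW hcardM
    rw [mul_pow (2 : ℝ), Real.sq_sqrt (Real.exp_pos _).le,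
      show (2 : ℝ) ^ 2 = 4 by norm_num] at hmain
    simpa only [hslab, hA, gNorm_embed, omegaM_embed] using hmain
  refine ofReal_one_sub_mul_le volume κ hκ.1.le hκ.2.le (volume_gNorm_ball_ne_top σ θ ε M hσ)
    (B := ⋃ p ∈ J, slab p) ?_ ?_
  · intro v hv
    by_contra hcon
    rw [Set.mem_union, not_or, Set.mem_iUnion₂] at hcon
    refine hcon.1 ⟨hv, fun m hm j hjR hjn hmr hjL => ?_⟩
    by_contra hle
    refine hcon.2 ⟨⟨m, j⟩, ?_, hv, (not_lt.1 hle).trans hδ⟩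
    refine Finset.mem_filter.2 ⟨Finset.mem_sigma.2 ⟨?_, ?_⟩, hjn⟩
    · have : 2 * m ≤ r := by exact_mod_cast hmr
      exact Finset.mem_Icc.2 ⟨hm, by simp only; omega⟩
    · refine Fintype.mem_piFinset.2 fun β => Finset.mem_product.2 ⟨?_, ?_⟩
      · simpa using hjR.1.1 β
      · rw [Finset.mem_Icc, ← abs_le]
        refine Int.le_floor.2 (le_trans ?_ (hjL β))
        rw [Int.abs_eq_natAbs]
        exact_mod_cast le_max_right _ _
  · calc volume (⋃ p ∈ J, slab p) ≤ ∑ p ∈ J, volume (slab p) := measure_biUnion_finset_le _ _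
      _ ≤ J.card • (ENNReal.ofReal q * volume A) := Finset.sum_le_card_nsmul _ _ _ hslab_le
      _ = ENNReal.ofReal (J.card * q) * volume A := by
        rw [nsmul_eq_mul, ← mul_assoc, ENNReal.ofReal_mul (by positivity),
          ENNReal.ofReal_natCast]
      _ ≤ ENNReal.ofReal κ * volume A := by
        gcongr
        have hJc : (J.card : ℝ) ≤ r * (5 * L) ^ r :=
          (Nat.cast_le.2 (Finset.card_filter_le _ _)).trans
            (card_boundedIndices_le r L (by linarith))
        have hq0 : 0 ≤ q := by positivity
        refine (mul_le_mul_of_nonneg_right hJc hq0).trans ?_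
        rw [hq, hδ₀, Real.exp_neg]
        exact union_bound_le ε κ M L _ hε hκ.1 r hr (by linarith) (by linarith)
          (Real.exp_pos _)
end
end

section
/- For every m ≥ 2 and every multi-index 𝐣 = ((δ_α,a_α))_{α=1}^{2m} ∈ (𝕌₂×ℤ)^{2m} which is not integrable, there exists an integer a* with |a*| < 3m and a* ∉ {a₁,…,a_{2m}} such that |∑_{α=1}^{2m} δ_α/(a* − a_α)²| ≥ 1/((6m)^{4m} · ∏_{α=1}^{2m} ⟨a_α⟩²), where ⟨a⟩ := max(1,|a|). -/
noncomputable section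

attribute [local instance] Classical.propDecidable

open scoped BigOperators

open Polynomial in
/-- The numerator of `∑ α, (j α).1 / (X - (j α).2) ^ 2` over the common denominator
`∏ b, (X - b) ^ 2`, where `b` runs over the distinct modes of `j`. -/
def numeratorPoly {n : ℕ} (j : Fin n → ℤ × ℤ) : ℤ[X] :=
  ∑ α, C (j α).1 * ∏ b ∈ (Finset.univ.image fun β => (j β).2).erase (j α).2, (X - C b) ^ 2

/-- A multi-index whose signs cancel at every mode is integrable. -/
theorem integ_of_sum_sign_eq_zero {n : ℕ} (j : Fin n → ℤ × ℤ) (hU2 : isU2 j)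
    (h : ∀ b : ℤ, ∑ α with (j α).2 = b, (j α).1 = 0) : integ j := by
  have hcard : ∀ b : ℤ, (Finset.univ.filter fun α => j α = (1, b)).card =
      (Finset.univ.filter fun α => j α = (-1, b)).card := by
    intro b
    have hsplit : ∀ α, (if (j α).2 = b then (j α).1 else 0) =
        (if j α = (1, b) then 1 else 0) - (if j α = (-1, b) then (1 : ℤ) else 0) := by
      intro α
      rcases hU2 α with h1 | h1 <;> by_cases h2 : (j α).2 = b <;> simp [Prod.ext_iff, h1, h2]
    have hb := h b
    rw [Finset.sum_filter, Finset.sum_congr rfl fun α _ => hsplit α,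
      Finset.sum_sub_distrib, Finset.sum_boole, Finset.sum_boole] at hb
    exact_mod_cast sub_eq_zero.mp hb
  have hfiber : ∀ p : ℤ × ℤ, Nonempty ({α // (-(j α).1, (j α).2) = p} ≃ {α // j α = p}) := by
    rintro ⟨d, b⟩
    refine ⟨Fintype.equivOfCardEq ?_⟩
    rw [Fintype.card_subtype, Fintype.card_subtype]
    have hneg : ∀ α, (-(j α).1, (j α).2) = (d, b) ↔ j α = (-d, b) := fun α => by
      simp [Prod.ext_iff, neg_eq_iff_eq_neg]
    simp only [hneg]
    by_cases h1 : d = 1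
    · subst h1; exact (hcard b).symm
    by_cases h2 : d = -1
    · subst h2; simpa using hcard b
    rw [Finset.filter_false_of_mem, Finset.filter_false_of_mem]
    · intro α _ hα
      rcases hU2 α with h3 | h3 <;> simp [hα] at h3 <;> omega
    · intro α _ hα
      rcases hU2 α with h3 | h3 <;> simp [hα] at h3 <;> omega
  exact ⟨Equiv.ofFiberEquiv fun p => (hfiber p).some, fun α => Equiv.ofFiberEquiv_map _ α⟩

theorem numeratorPoly_ne_zero {n : ℕ} (j : Fin n → ℤ × ℤ) (hU2 : isU2 j) (hni : ¬ integ j) :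
    numeratorPoly j ≠ 0 := by
  obtain ⟨b, hb⟩ : ∃ b : ℤ, ∑ α with (j α).2 = b, (j α).1 ≠ 0 := by
    by_contra! h
    exact hni (integ_of_sum_sign_eq_zero j hU2 h)
  have heval : (numeratorPoly j).eval b = (∑ α with (j α).2 = b, (j α).1) *
      ∏ c ∈ (Finset.univ.image fun β => (j β).2).erase b, (b - c) ^ 2 := by
    simp only [numeratorPoly, Polynomial.eval_finsetSum, Polynomial.eval_mul,
      Polynomial.eval_C, Polynomial.eval_prod, Polynomial.eval_pow, Polynomial.eval_sub,
      Polynomial.eval_X]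
    rw [Finset.sum_mul, Finset.sum_filter]
    refine Finset.sum_congr rfl fun α _ => ?_
    split_ifs with hα
    · rw [hα]
    · have hmem : b ∈ Finset.univ.image fun β => (j β).2 := by
        by_contra hb'
        refine hb (Finset.sum_eq_zero fun β hβ => (hb' ?_).elim)
        exact Finset.mem_image.2 ⟨β, Finset.mem_univ _, (Finset.mem_filter.1 hβ).2⟩
      rw [Finset.prod_eq_zero (Finset.mem_erase.2 ⟨fun h => hα h.symm, hmem⟩) (by simp), mul_zero]
  intro h0
  rw [h0, Polynomial.eval_zero] at heval
  refine mul_ne_zero hb (Finset.prod_ne_zero_iff.2 fun c hc => ?_) heval.symm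
  exact pow_ne_zero _ (sub_ne_zero.2 (Finset.ne_of_mem_erase hc).symm)

theorem natDegree_numeratorPoly_le {n : ℕ} (j : Fin n → ℤ × ℤ) :
    (numeratorPoly j).natDegree ≤ 2 * ((Finset.univ.image fun β => (j β).2).card - 1) := by
  refine Polynomial.natDegree_sum_le_of_forall_le _ _ fun α _ => ?_
  refine (Polynomial.natDegree_C_mul_le _ _).trans ((Polynomial.natDegree_prod_le _ _).trans ?_)
  simp only [Polynomial.natDegree_pow, Polynomial.natDegree_X_sub_C, Finset.sum_const]
  rw [Finset.card_erase_of_mem (Finset.mem_image_of_mem _ (Finset.mem_univ _)), smul_eq_mul]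
  omega

/-- Away from the modes of `j`, the polynomial `numeratorPoly j` is the sum of fractions times
the common denominator. -/
theorem eval_numeratorPoly {n : ℕ} (j : Fin n → ℤ × ℤ) (x : ℤ) (hx : ∀ α, x ≠ (j α).2) :
    (((numeratorPoly j).eval x : ℤ) : ℝ) = (∑ α, ((j α).1 : ℝ) / ((x : ℝ) - ((j α).2 : ℝ)) ^ 2) *
      ∏ b ∈ Finset.univ.image fun β => (j β).2, ((x : ℝ) - b) ^ 2 := by
  simp only [numeratorPoly, Polynomial.eval_finsetSum, Polynomial.eval_mul,
    Polynomial.eval_C, Polynomial.eval_prod, Polynomial.eval_pow, Polynomial.eval_sub,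
    Polynomial.eval_X]
  push_cast
  rw [Finset.sum_mul]
  refine Finset.sum_congr rfl fun α _ => ?_
  rw [← Finset.mul_prod_erase _ _ (Finset.mem_image_of_mem (fun β => (j β).2) (Finset.mem_univ α))]
  have : (x : ℝ) - ((j α).2 : ℝ) ≠ 0 := sub_ne_zero.2 (by exact_mod_cast hx α)
  field_simp

/-- A product of factors `≥ 1` over the image of a map is at most the product over the source. -/
theorem prod_image_le_prod_comp {ι κ : Type*} [DecidableEq κ] (s : Finset ι) (g : ι → κ)
    (f : κ → ℝ) (hf : ∀ b, 1 ≤ f b) : ∏ b ∈ s.image g, f b ≤ ∏ i ∈ s, f (g i) := by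
  rw [Finset.prod_comp f g]
  refine Finset.prod_le_prod (fun b _ => zero_le_one.trans (hf b)) fun b hb => ?_
  obtain ⟨i, hi, rfl⟩ := Finset.mem_image.1 hb
  refine le_self_pow₀ (hf _) (Finset.card_ne_zero_of_mem (a := i) ?_)
  simp [hi]

theorem one_le_brk (a : ℤ) : (1 : ℝ) ≤ brk a := by
  exact_mod_cast le_max_left 1 a.natAbs

theorem sq_sub_le_brk {m : ℕ} (x b : ℤ) (hx : |x| < 3 * m) :
    ((x : ℝ) - b) ^ 2 ≤ (6 * m * brk b : ℝ) ^ 2 := by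
  have hb : |(b : ℝ)| ≤ brk b := by
    have : |b| ≤ (brk b : ℤ) := by rw [Int.abs_eq_natAbs]; exact_mod_cast le_max_right _ _
    exact_mod_cast this
  have hx' : |(x : ℝ)| + 1 ≤ 3 * m := by exact_mod_cast hx
  have h1 := one_le_brk b
  have h0 := abs_nonneg (x : ℝ)
  rw [sq_le_sq]
  refine (abs_sub _ _).trans (le_trans ?_ (le_abs_self _))
  nlinarith

/-- There is an integer of modulus `< 3m` which is neither a mode of `j` nor a root of
`numeratorPoly j`. -/
theorem exists_eval_numeratorPoly_ne_zero (m : ℕ) (hm : 2 ≤ m) (j : Fin (2 * m) → ℤ × ℤ)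
    (hU2 : isU2 j) (hni : ¬ integ j) :
    ∃ x : ℤ, |x| < 3 * m ∧ (∀ α, x ≠ (j α).2) ∧ (numeratorPoly j).eval x ≠ 0 := by
  set S := Finset.univ.image fun β => (j β).2
  have hScard : S.card ≤ 2 * m := by
    simpa using Finset.card_image_le (s := Finset.univ) (f := fun β => (j β).2)
  have hSpos : 0 < S.card := by
    refine Finset.card_pos.2 ⟨(j ⟨0, by omega⟩).2, ?_⟩
    exact Finset.mem_image_of_mem (fun β => (j β).2) (Finset.mem_univ _)
  have hroots : (numeratorPoly j).roots.toFinset.card ≤ 2 * (S.card - 1) :=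
    (Multiset.toFinset_card_le _).trans
      ((Polynomial.card_roots' _).trans (natDegree_numeratorPoly_le j))
  have hlt : (S ∪ (numeratorPoly j).roots.toFinset).card <
      (Finset.Ioo (-(3 * m : ℤ)) (3 * m)).card := by
    have := Finset.card_union_le S (numeratorPoly j).roots.toFinset
    rw [Int.card_Ioo]
    omega
  obtain ⟨x, hx, hxn⟩ := Finset.exists_mem_notMem_of_card_lt_card hlt
  rw [Finset.mem_union, not_or] at hxn
  refine ⟨x, abs_lt.2 (Finset.mem_Ioo.1 hx), fun α hα => hxn.1 ?_, fun h0 => hxn.2 ?_⟩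
  · rw [hα]
    exact Finset.mem_image_of_mem (fun β => (j β).2) (Finset.mem_univ α)
  · rw [Multiset.mem_toFinset, Polynomial.mem_roots (numeratorPoly_ne_zero j hU2 hni)]
    exact h0

/-- **Statement 14.** For every `m ≥ 2` and every non-integrable multi-index
`𝐣 = ((δ_α, a_α))_{α=1}^{2m} ∈ (𝕌₂×ℤ)^{2m}`, there exists an integer `a*` with `|a*| < 3m`,
`a* ∉ {a₁, …, a_{2m}}` and `|∑_α δ_α/(a* - a_α)²| ≥ ((6m)^{4m} ∏_α ⟨a_α⟩²)⁻¹`. -/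
theorem stmt14 (m : ℕ) (hm : 2 ≤ m) (j : Fin (2 * m) → ℤ × ℤ)
    (hU2 : isU2 j) (hni : ¬ integ j) :
    ∃ aStar : ℤ, |aStar| < 3 * m ∧ (∀ α, aStar ≠ (j α).2) ∧
      1 / ((6 * m : ℝ) ^ (4 * m) * ∏ α, (brk ((j α).2) : ℝ) ^ 2)
        ≤ |∑ α, ((j α).1 : ℝ) / ((aStar : ℝ) - ((j α).2 : ℝ)) ^ 2| := by
  obtain ⟨x, hx, hxj, hne⟩ := exists_eval_numeratorPoly_ne_zero m hm j hU2 hni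
  refine ⟨x, hx, hxj, ?_⟩
  set f := ∑ α, ((j α).1 : ℝ) / ((x : ℝ) - ((j α).2 : ℝ)) ^ 2
  have hm' : (2 : ℝ) ≤ m := by exact_mod_cast hm
  have hden : ∏ b ∈ Finset.univ.image fun β => (j β).2, ((x : ℝ) - b) ^ 2 ≤
      (6 * m : ℝ) ^ (4 * m) * ∏ α, (brk ((j α).2) : ℝ) ^ 2 :=
    calc ∏ b ∈ Finset.univ.image fun β => (j β).2, ((x : ℝ) - b) ^ 2
        ≤ ∏ b ∈ Finset.univ.image fun β => (j β).2, (6 * m * brk b : ℝ) ^ 2 :=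
          Finset.prod_le_prod (fun b _ => sq_nonneg _) fun b _ => sq_sub_le_brk x b hx
      _ ≤ ∏ α, (6 * m * brk (j α).2 : ℝ) ^ 2 :=
          prod_image_le_prod_comp _ _ (fun b : ℤ => (6 * m * brk b : ℝ) ^ 2) fun b =>
            one_le_pow₀ (by nlinarith [one_le_brk b])
      _ = (6 * m : ℝ) ^ (4 * m) * ∏ α, (brk ((j α).2) : ℝ) ^ 2 := by
          simp only [mul_pow _ (brk _ : ℝ), Finset.prod_mul_distrib, Finset.prod_const,
            Finset.card_univ, Fintype.card_fin, ← pow_mul]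
          congr 2
          ring
  have hone : (1 : ℝ) ≤ |f| * ∏ b ∈ Finset.univ.image fun β => (j β).2, ((x : ℝ) - b) ^ 2 := by
    rw [← abs_of_nonneg (Finset.prod_nonneg fun (b : ℤ) _ => sq_nonneg ((x : ℝ) - (b : ℝ))), ← abs_mul,
      ← eval_numeratorPoly j x hxj]
    exact_mod_cast Int.one_le_abs hne
  have hpos : 0 < (6 * m : ℝ) ^ (4 * m) * ∏ α, (brk ((j α).2) : ℝ) ^ 2 :=
    mul_pos (by positivity) (Finset.prod_pos fun α _ => pow_pos
      (zero_lt_one.trans_le (one_le_brk _)) 2)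
  rw [div_le_iff₀ hpos]
  exact hone.trans (mul_le_mul_of_nonneg_left hden (abs_nonneg f))
end
end

section
/- Let m, N ≥ 1 and θ ∈ (0,1). For every multi-index 𝐣 = (j₁,…,j_{2m}) ∈ M_m with μ₃(𝐣) > N: ∑_{β=2}^{2m} |j_β|^θ − (∑_{β=2}^{2m} |j_β|)^θ ≥ (1−θ) N^θ. -/
noncomputable section

attribute [local instance] Classical.propDecidable

open scoped BigOperators

/-- `mu k v` is the `k`-th largest value of `v` (for `1 ≤ k ≤ n`). -/
def mu {n : ℕ} (k : ℕ) (v : Fin n → ℕ) : ℕ :=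
  if h : 1 ≤ k ∧ k ≤ n then v (Tuple.sort v ⟨n - k, by omega⟩) else 0


theorem exists_pair_ne_of_lt_mu_three {n N : ℕ} (v : Fin n → ℕ) (h : N < mu 3 v) (z : Fin n) :
    ∃ a b, a ≠ b ∧ a ≠ z ∧ b ≠ z ∧ N < v a ∧ N < v b := by
  unfold mu at h
  split_ifs at h with hn
  · have large (i : Fin n) (hi : n - 3 ≤ i.val) : N < v (Tuple.sort v i) :=
      h.trans_le (Tuple.monotone_sort v (Fin.mk_le_of_le_val hi))
    have h₁ := large ⟨n - 1, by omega⟩ (by simp only; omega)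
    have h₂ := large ⟨n - 2, by omega⟩ (by simp only; omega)
    have h₁₂ : Tuple.sort v ⟨n - 1, by omega⟩ ≠ Tuple.sort v ⟨n - 2, by omega⟩ := by
      simp only [ne_eq, EmbeddingLike.apply_eq_iff_eq, Fin.mk.injEq]; omega
    have h₁₃ : Tuple.sort v ⟨n - 1, by omega⟩ ≠ Tuple.sort v ⟨n - 3, by omega⟩ := by
      simp only [ne_eq, EmbeddingLike.apply_eq_iff_eq, Fin.mk.injEq]; omega
    have h₂₃ : Tuple.sort v ⟨n - 2, by omega⟩ ≠ Tuple.sort v ⟨n - 3, by omega⟩ := by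
      simp only [ne_eq, EmbeddingLike.apply_eq_iff_eq, Fin.mk.injEq]; omega
    by_cases e₁ : Tuple.sort v ⟨n - 1, by omega⟩ = z
    · exact ⟨_, _, h₂₃, e₁ ▸ h₁₂.symm, e₁ ▸ h₁₃.symm, h₂, h⟩
    by_cases e₂ : Tuple.sort v ⟨n - 2, by omega⟩ = z
    · exact ⟨_, _, h₁₃, e₁, e₂ ▸ h₂₃.symm, h₁, h⟩
    · exact ⟨_, _, h₁₂, e₁, e₂, h₁, h₂⟩
  · omega

theorem add_rpow_le_rpow_add_mul_rpow {θ x y : ℝ} (h0 : 0 ≤ θ) (h1 : θ ≤ 1) (hy : 0 < y)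
    (hyx : y ≤ x) : (x + y) ^ θ ≤ x ^ θ + θ * y ^ θ := by
  have hx : 0 < x := hy.trans_le hyx
  have hr : 0 ≤ y / x := by positivity
  have bernoulli : (1 + y / x) ^ θ ≤ 1 + θ * (y / x) :=
    rpow_one_add_le_one_add_mul_self (by linarith) h0 h1
  have self_le : y / x ≤ (y / x) ^ θ :=
    Real.self_le_rpow_of_le_one hr ((div_le_one hx).2 hyx) h1
  calc (x + y) ^ θ = x ^ θ * (1 + y / x) ^ θ := by
        rw [← Real.mul_rpow hx.le (by positivity), mul_add, mul_one, mul_div_cancel₀ _ hx.ne']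
    _ ≤ x ^ θ * (1 + θ * (y / x) ^ θ) := by
        gcongr
        exact bernoulli.trans (by gcongr)
    _ = x ^ θ + θ * y ^ θ := by
        rw [Real.div_rpow hy.le hx.le]
        have := (Real.rpow_pos_of_pos hx θ).ne'
        field_simp

theorem one_sub_mul_rpow_le_rpow_add_rpow_sub {θ c x y : ℝ} (h0 : 0 ≤ θ) (h1 : θ ≤ 1)
    (hc : 0 < c) (hx : c ≤ x) (hy : c ≤ y) :
    (1 - θ) * c ^ θ ≤ x ^ θ + y ^ θ - (x + y) ^ θ := by
  wlog hyx : y ≤ x generalizing x y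
  · simpa only [add_comm] using this hy hx (le_of_not_ge hyx)
  have hcy : (1 - θ) * c ^ θ ≤ (1 - θ) * y ^ θ :=
    mul_le_mul_of_nonneg_left (Real.rpow_le_rpow hc.le hy h0) (sub_nonneg.2 h1)
  linarith [add_rpow_le_rpow_add_mul_rpow h0 h1 (hc.trans_le hy) hyx]

theorem rpow_sum_le_sum_rpow {ι : Type*} {θ : ℝ} (h0 : 0 < θ) (h1 : θ ≤ 1) (s : Finset ι)
    (f : ι → ℝ) (hf : ∀ i ∈ s, 0 ≤ f i) : (∑ i ∈ s, f i) ^ θ ≤ ∑ i ∈ s, f i ^ θ :=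
  Finset.le_sum_of_subadditive_on_pred (· ^ θ) (0 ≤ ·) (Real.zero_rpow h0.ne').le
    (fun _ _ hx hy => Real.rpow_add_le_add_rpow hx hy h0.le h1) (fun _ _ => add_nonneg) f hf

theorem one_sub_mul_rpow_le_sum_rpow_sub {ι : Type*} [DecidableEq ι] {θ c : ℝ} (h0 : 0 < θ)
    (h1 : θ ≤ 1) (hc : 0 < c) (s : Finset ι) (f : ι → ℝ) (hf : ∀ i ∈ s, 0 ≤ f i) {a b : ι}
    (ha : a ∈ s) (hb : b ∈ s) (hab : a ≠ b) (hca : c ≤ f a) (hcb : c ≤ f b) :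
    (1 - θ) * c ^ θ ≤ ∑ i ∈ s, f i ^ θ - (∑ i ∈ s, f i) ^ θ := by
  have hb' : b ∈ s.erase a := Finset.mem_erase.2 ⟨hab.symm, hb⟩
  have hrest : ∀ i ∈ (s.erase a).erase b, 0 ≤ f i := fun i hi =>
    hf i (Finset.mem_of_mem_erase (Finset.mem_of_mem_erase hi))
  rw [← Finset.add_sum_erase s _ ha, ← Finset.add_sum_erase _ _ hb', ← Finset.add_sum_erase s f ha,
    ← Finset.add_sum_erase _ f hb', ← add_assoc (f a)]
  have split := Real.rpow_add_le_add_rpow (add_nonneg (hf a ha) (hf b hb))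
    (Finset.sum_nonneg hrest) h0.le h1
  linarith [rpow_sum_le_sum_rpow h0 h1 _ f hrest,
    one_sub_mul_rpow_le_rpow_add_rpow_sub h0.le h1 hc hca hcb]

theorem natCast_le_abs_of_lt_brk {N : ℕ} {a : ℤ} (hN : 1 ≤ N) (h : N < brk a) :
    (N : ℝ) ≤ |(a : ℝ)| := by
  rw [← Int.cast_abs, Int.abs_eq_natAbs, Int.cast_natCast, Nat.cast_le]
  unfold brk at h
  omega

/-- **Statement 15.** Let `m, N ≥ 1` and `θ ∈ (0,1)`. For every multi-index
`𝐣 = (j₁, …, j_{2m}) ∈ M_m` with `μ₃(𝐣) > N`: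
`∑_{β=2}^{2m} |j_β|^θ - (∑_{β=2}^{2m} |j_β|)^θ ≥ (1-θ) N^θ`. -/
theorem stmt15 (m N : ℕ) (hm : 1 ≤ m) (hN : 1 ≤ N) (θ : ℝ) (hθ : θ ∈ Set.Ioo (0 : ℝ) 1)
    (j : Fin (2 * m) → ℤ × ℤ) (hj : inM j)
    (hmu : (N : ℝ) < (mu 3 (fun α => brk ((j α).2)) : ℝ)) :
    (1 - θ) * (N : ℝ) ^ θ ≤
      (∑ β ∈ Finset.univ.erase (⟨0, by omega⟩ : Fin (2 * m)), |(((j β).2 : ℝ))| ^ θ) -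
        (∑ β ∈ Finset.univ.erase (⟨0, by omega⟩ : Fin (2 * m)), |(((j β).2 : ℝ))|) ^ θ := by
  obtain ⟨a, b, hab, ha, hb, hNa, hNb⟩ :=
    exists_pair_ne_of_lt_mu_three _ (Nat.cast_lt.1 hmu) (⟨0, by omega⟩ : Fin (2 * m))
  exact one_sub_mul_rpow_le_sum_rpow_sub hθ.1 hθ.2.le (by exact_mod_cast hN) _
    (fun β => |((j β).2 : ℝ)|) (fun _ _ => abs_nonneg _)
    (Finset.mem_erase.2 ⟨ha, Finset.mem_univ a⟩) (Finset.mem_erase.2 ⟨hb, Finset.mem_univ b⟩) hab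
    (natCast_le_abs_of_lt_brk hN hNa) (natCast_le_abs_of_lt_brk hN hNb)
end
end

section
/- There exists ε₀* > 0, depending only on σ and θ, such that for every ε₀ ∈ (0, ε₀*]: if z⁽⁰⁾ ∈ 𝒢 satisfies ‖z⁽⁰⁾‖_σ ≤ 1 and |ω_𝐣^∞(z⁽⁰⁾)| ≥ ε₀^{1/6} · η_𝐣 for every 𝐣 ∈ 𝓝, where for a multi-index 𝐣 with 2m entries η_𝐣 := (1/160) · μ₁(𝐣)^{−12m} · (180m)^{−4m−4} · e^{−6σm}, then ε·z⁽⁰⁾ ∈ Θ_ε for every ε ∈ (0, ε₀]. -/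
noncomputable section

attribute [local instance] Classical.propDecidable

open scoped BigOperators

/-- `μ₁(𝐣)`: the largest of the `⟨a_α⟩`. -/
def mu1 {n : ℕ} (j : Fin n → ℤ × ℤ) : ℕ := Finset.univ.sup fun α => brk ((j α).2)

lemma omegaM_PiM_smul (M ε : ℝ) {n : ℕ} (j : Fin n → ℤ × ℤ) (z : ℤ → ℂ) :
    omegaM M j (PiM M fun a => (ε : ℂ) * z a) = ε ^ 2 * omegaM M j z := by
  unfold omegaM
  rw [Finset.mul_sum]
  refine Finset.sum_congr rfl fun β _ => ?_
  rw [mul_left_comm (ε ^ 2)]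
  congr 1
  rw [← tsum_mul_left]
  refine tsum_congr fun a => ?_
  by_cases h : a ≠ (j β).2 ∧ |(a : ℝ)| ≤ M
  · simp only [h, PiM, if_true, norm_mul, Complex.norm_real, mul_pow, Real.norm_eq_abs, sq_abs,
      ne_eq, not_false_eq_true, and_self]
    ring
  · simp only [h, if_false, mul_zero]

lemma one_le_wt {σ θ : ℝ} (hσ : 0 < σ) (a : ℤ) : 1 ≤ wt σ θ a :=
  Real.one_le_exp (mul_nonneg hσ.le (Real.rpow_nonneg (abs_nonneg _) _))

lemma wt_mul_norm_le_one {σ θ : ℝ} {z : ℤ → ℂ} (hz : inG σ θ z) (h1 : gNorm σ θ z ≤ 1) (a : ℤ) :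
    wt σ θ a * ‖z a‖ ≤ 1 := by
  have h := hz.le_tsum a fun b _ => mul_nonneg (Real.exp_pos _).le (norm_nonneg (z b))
  unfold gNorm at h1
  linarith [mul_nonneg (Real.exp_pos (σ * |(a : ℝ)| ^ θ)).le (norm_nonneg (z a))]

lemma norm_sq_div_sq_sub_le {z : ℤ → ℂ} {a b : ℤ} (h : a ≠ b) :
    ‖z a‖ ^ 2 / ((a : ℝ) - b) ^ 2 ≤ ‖z a‖ ^ 2 := by
  refine div_le_self (sq_nonneg _) ?_
  have : 0 < (a - b) ^ 2 := by
    have := sub_ne_zero.mpr h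
    positivity
  exact_mod_cast this

lemma abs_omegaInf_sub_omegaM_le {σ θ M : ℝ} (hσ : 0 < σ) (hθ : 0 < θ) (hM : 0 ≤ M)
    {z : ℤ → ℂ} (hz : inG σ θ z) (h1 : gNorm σ θ z ≤ 1) {n : ℕ} (j : Fin n → ℤ × ℤ)
    (hj : isU2 j) :
    |omegaInf j z - omegaM M j z| ≤ n * Real.exp (-(2 * σ * M ^ θ)) := by
  unfold omegaInf omegaM
  rw [← Finset.sum_sub_distrib]
  refine (Finset.abs_sum_le_sum_abs _ _).trans ?_
  have hcard : (n : ℝ) * Real.exp (-(2 * σ * M ^ θ))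
      = ∑ _β : Fin n, Real.exp (-(2 * σ * M ^ θ)) := by simp
  rw [hcard]
  refine Finset.sum_le_sum fun β _ => ?_
  set b := (j β).2
  set f : ℤ → ℝ := fun a => if a ≠ b then ‖z a‖ ^ 2 / ((a : ℝ) - b) ^ 2 else 0 with hf
  set g : ℤ → ℝ := fun a => if a ≠ b ∧ |(a : ℝ)| ≤ M then
    ‖z a‖ ^ 2 / ((a : ℝ) - b) ^ 2 else 0 with hg
  have hfz : ∀ a, f a ≤ ‖z a‖ ^ 2 := fun a => by
    by_cases h : a = b
    · simp [hf, h]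
    · simpa only [hf, ne_eq, h, not_false_eq_true, if_true] using norm_sq_div_sq_sub_le h
  have hf0 : ∀ a, 0 ≤ f a := fun a => by simp only [hf]; split_ifs <;> positivity
  have hg0 : ∀ a, 0 ≤ g a := fun a => by simp only [hg]; split_ifs <;> positivity
  have hgf : ∀ a, g a ≤ f a := fun a => by
    by_cases h' : |(a : ℝ)| ≤ M
    · simp only [hf, hg, h', and_true, le_refl]
    · simpa only [hg, h', and_false, if_false] using hf0 a
  have hsq : ∀ a, ‖z a‖ ^ 2 ≤ wt σ θ a * ‖z a‖ := fun a => by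
    have := wt_mul_norm_le_one hz h1 a
    nlinarith [norm_nonneg (z a), one_le_wt (θ := θ) hσ a]
  have hfs : Summable f := Summable.of_nonneg_of_le hf0 (fun a => (hfz a).trans (hsq a)) hz
  have hgs : Summable g := Summable.of_nonneg_of_le hg0 hgf hfs
  have hterm : ∀ a, f a - g a ≤ Real.exp (-(2 * σ * M ^ θ)) * (wt σ θ a * ‖z a‖) := fun a => by
    by_cases h' : |(a : ℝ)| ≤ M
    · have : f a - g a = 0 := by simp only [hf, hg, h', and_true, sub_self]
      rw [this]
      exact mul_nonneg (Real.exp_pos _).le (mul_nonneg (Real.exp_pos _).le (norm_nonneg _))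
    · have hw1 := wt_mul_norm_le_one hz h1 a
      have hw0 : 0 < wt σ θ a := Real.exp_pos _
      have hE : 1 ≤ Real.exp (-(2 * σ * M ^ θ)) * (wt σ θ a) ^ 2 := by
        unfold wt
        rw [← Real.exp_nat_mul, ← Real.exp_add]
        apply Real.one_le_exp
        have := Real.rpow_le_rpow hM (not_le.mp h').le hθ.le
        push_cast
        nlinarith
      calc f a - g a ≤ ‖z a‖ ^ 2 := by linarith [hfz a, hg0 a]
        _ ≤ ‖z a‖ ^ 2 * (Real.exp (-(2 * σ * M ^ θ)) * (wt σ θ a) ^ 2) :=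
            le_mul_of_one_le_right (sq_nonneg _) hE
        _ = Real.exp (-(2 * σ * M ^ θ)) * (wt σ θ a * ‖z a‖) * (wt σ θ a * ‖z a‖) := by ring
        _ ≤ Real.exp (-(2 * σ * M ^ θ)) * (wt σ θ a * ‖z a‖) :=
            mul_le_of_le_one_right (by positivity) hw1
  have habs : |((j β).1 : ℝ)| = 1 := by
    rcases hj β with h | h <;> simp [h]
  rw [← mul_sub, abs_mul, habs, one_mul, ← hfs.tsum_sub hgs,
    abs_of_nonneg (tsum_nonneg fun a => sub_nonneg.mpr (hgf a))]
  refine ((hfs.sub hgs).tsum_le_tsum hterm (hz.mul_left _)).trans ?_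
  rw [tsum_mul_left]
  refine mul_le_of_le_one_right (Real.exp_pos _).le ?_
  unfold gNorm at h1
  have h0 : 0 ≤ ∑' a : ℤ, wt σ θ a * ‖z a‖ :=
    tsum_nonneg fun a => mul_nonneg (Real.exp_pos _).le (norm_nonneg _)
  linarith

/-- The largeness conditions imposed on `ℓ = log ε⁻¹`. -/
structure LargeLog (σ ℓ : ℝ) : Prop where
  one_le : 1 ≤ ℓ
  one_le_log : 1 ≤ Real.log ℓ
  le_log : σ ≤ Real.log ℓ
  log_le : 4 * Real.log ℓ ≤ ℓ / 100
  lt_exp : 1760 < Real.exp (ℓ / 50)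
  le_mul_cube : 3 / 2 ≤ 2 * σ * ℓ ^ 3

lemma eventually_largeLog {σ : ℝ} (hσ : 0 < σ) : ∀ᶠ ℓ in Filter.atTop, LargeLog σ ℓ := by
  have hlog := Real.tendsto_log_atTop
  have hexp : Filter.Tendsto (fun ℓ : ℝ => Real.exp (ℓ / 50)) Filter.atTop Filter.atTop :=
    Real.tendsto_exp_atTop.comp (Filter.tendsto_id.atTop_div_const (by norm_num))
  have hcube : Filter.Tendsto (fun ℓ : ℝ => 2 * σ * ℓ ^ 3) Filter.atTop Filter.atTop :=
    (Filter.tendsto_pow_atTop (by norm_num)).const_mul_atTop (by positivity)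
  have ho := Real.isLittleO_log_id_atTop.def (c := 1 / 400) (by norm_num)
  filter_upwards [Filter.eventually_ge_atTop 1, hlog.eventually_ge_atTop 1,
    hlog.eventually_ge_atTop σ, ho, hexp.eventually_gt_atTop 1760,
    hcube.eventually_ge_atTop (3 / 2)] with ℓ h1 h2 h3 h4 h5 h6
  refine ⟨h1, h2, h3, ?_, h5, h6⟩
  simp only [id, Real.norm_eq_abs] at h4
  rw [abs_of_nonneg (zero_le_one.trans h2), abs_of_nonneg (zero_le_one.trans h1)] at h4
  linarith

/-- The lower bound on `η_𝐣`, given the bounds on the order and on the size of the indices. -/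
lemma lt_eta {σ θ ℓ μ : ℝ} (hσ : 0 < σ) (hθ : θ ∈ Set.Ioo (0 : ℝ) 1) (hℓ : LargeLog σ ℓ)
    {m : ℕ} (hm : 1 ≤ m) (hmℓ : m * Real.log ℓ ≤ 3 * (min 1 σ * θ * (1 - θ) / 500) * ℓ)
    (hm180 : 180 * (m : ℝ) ≤ ℓ) (hμ0 : 0 < μ) (hμ : μ ≤ ℓ ^ (1 + 4 / θ)) :
    11 * Real.exp (-(ℓ / 3)) <
      (1 / 160) * (μ ^ (12 * m))⁻¹ * ((180 * m : ℝ) ^ (4 * m + 4))⁻¹ *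
        Real.exp (-(6 * σ * m)) := by
  obtain ⟨hθ0, hθ1⟩ := hθ
  have h0 : 0 < ℓ := by linarith [hℓ.one_le]
  have hm0 : (1 : ℝ) ≤ m := by exact_mod_cast hm
  have hℓe : Real.exp (Real.log ℓ) = ℓ := Real.exp_log h0
  set l := Real.log ℓ with hl
  have hl1 : 1 ≤ l := hℓ.one_le_log
  have hμe : (μ ^ (12 * m))⁻¹ ≥ Real.exp (-(12 * m * (l * (1 + 4 / θ)))) := by
    rw [Real.exp_neg]
    refine inv_anti₀ (by positivity) ?_
    calc μ ^ (12 * m) ≤ (ℓ ^ (1 + 4 / θ)) ^ (12 * m) := pow_le_pow_left₀ hμ0.le hμ _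
      _ = _ := by
        rw [Real.rpow_def_of_pos h0, ← Real.exp_nat_mul]
        push_cast
        rfl
  have hme : ((180 * m : ℝ) ^ (4 * m + 4))⁻¹ ≥ Real.exp (-((4 * m + 4) * l)) := by
    rw [Real.exp_neg]
    refine inv_anti₀ (by positivity) ?_
    calc (180 * m : ℝ) ^ (4 * m + 4) ≤ ℓ ^ (4 * m + 4) := pow_le_pow_left₀ (by positivity) hm180 _
      _ = _ := by
        rw [← hℓe, ← Real.exp_nat_mul]
        push_cast
        rfl
  have hmin1 : min 1 σ ≤ 1 := min_le_left _ _
  have hmin0 : 0 < min 1 σ := lt_min one_pos hσ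
  have hmain : m * l * (16 + 48 / θ) ≤ 144 / 500 * ℓ := by
    calc m * l * (16 + 48 / θ)
        ≤ 3 * (min 1 σ * θ * (1 - θ) / 500) * ℓ * (16 + 48 / θ) :=
          mul_le_mul_of_nonneg_right hmℓ (by positivity)
      _ = min 1 σ * (3 * ((1 - θ) * (16 * θ + 48)) / 500 * ℓ) := by
          field_simp
      _ ≤ 1 * (3 * ((1 - θ) * (16 * θ + 48)) / 500 * ℓ) := by
          refine mul_le_mul_of_nonneg_right hmin1 ?_
          have : 0 < 1 - θ := by linarith
          positivity
      _ ≤ 144 / 500 * ℓ := by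
          rw [one_mul]
          refine mul_le_mul_of_nonneg_right ?_ h0.le
          nlinarith
  have hc : min 1 σ * θ * (1 - θ) / 500 ≤ 1 / 2000 := by
    have : θ * (1 - θ) ≤ 1 / 4 := by nlinarith [sq_nonneg (θ - 1 / 2)]
    have : 0 ≤ θ * (1 - θ) := mul_nonneg hθ0.le (by linarith)
    nlinarith
  have hσm : 6 * σ * m ≤ 18 / 2000 * ℓ := by
    have h1 : σ * m ≤ m * l := by nlinarith [hℓ.le_log]
    have h2 : 3 * (min 1 σ * θ * (1 - θ) / 500) * ℓ ≤ 3 * (1 / 2000) * ℓ := by gcongr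
    linarith
  have hlog := hℓ.log_le
  have hsum : -(12 * m * (l * (1 + 4 / θ))) + -((4 * m + 4) * l) + -(6 * σ * m)
      ≥ ℓ / 50 + -(ℓ / 3) := by
    have : 12 * m * (l * (1 + 4 / θ)) + 4 * m * l = m * l * (16 + 48 / θ) := by
      field_simp
      ring
    linarith
  calc 11 * Real.exp (-(ℓ / 3)) = (1 / 160) * (1760 * Real.exp (-(ℓ / 3))) := by ring
    _ < (1 / 160) * (Real.exp (ℓ / 50) * Real.exp (-(ℓ / 3))) := by
        gcongr
        exact hℓ.lt_exp
    _ = (1 / 160) * Real.exp (ℓ / 50 + -(ℓ / 3)) := by rw [Real.exp_add]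
    _ ≤ (1 / 160) * Real.exp
          (-(12 * m * (l * (1 + 4 / θ))) + -((4 * m + 4) * l) + -(6 * σ * m)) := by gcongr
    _ = (1 / 160) * Real.exp (-(12 * m * (l * (1 + 4 / θ)))) * Real.exp (-((4 * m + 4) * l)) *
          Real.exp (-(6 * σ * m)) := by rw [Real.exp_add, Real.exp_add]; ring
    _ ≤ _ := by gcongr

lemma mul_exp_neg_tail_le {σ ℓ t x : ℝ} (hσ : 0 < σ) (hℓ : LargeLog σ ℓ) (hx : x ≤ ℓ)
    (ht : ℓ ^ 4 ≤ t) : x * Real.exp (-(2 * σ * t)) ≤ Real.exp (-(ℓ / 2)) := by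
  have h1 := hℓ.one_le
  have hexp : ℓ ≤ Real.exp ℓ := by linarith [Real.add_one_le_exp ℓ]
  calc x * Real.exp (-(2 * σ * t)) ≤ Real.exp ℓ * Real.exp (-(2 * σ * t)) :=
        mul_le_mul_of_nonneg_right (hx.trans hexp) (Real.exp_pos _).le
    _ = Real.exp (ℓ + -(2 * σ * t)) := (Real.exp_add _ _).symm
    _ ≤ Real.exp (-(ℓ / 2)) := by
        gcongr
        have h2 : 3 / 2 * ℓ ≤ 2 * σ * ℓ ^ 3 * ℓ :=
          mul_le_mul_of_nonneg_right hℓ.le_mul_cube (by linarith)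
        have h3 : 2 * σ * ℓ ^ 4 ≤ 2 * σ * t := by gcongr
        nlinarith

lemma one_le_mu1 {n : ℕ} [NeZero n] (j : Fin n → ℤ × ℤ) : 1 ≤ mu1 j :=
  (le_max_left 1 _).trans (Finset.le_sup (f := fun α => brk (j α).2) (Finset.mem_univ 0))

lemma mu1_le {n : ℕ} {M : ℝ} (hM : 0 ≤ M) (j : Fin n → ℤ × ℤ)
    (h : ∀ β, (brk (j β).2 : ℝ) ≤ M) : (mu1 j : ℝ) ≤ M := by
  have : mu1 j ≤ ⌊M⌋₊ := Finset.sup_le fun β _ => Nat.le_floor (h β)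
  exact (Nat.cast_le.mpr this).trans (Nat.floor_le hM)

/-- **Statement 17.** Deterministic part of the probability estimate: if `‖z⁰‖_σ ≤ 1` and
`|ω_𝐣^∞(z⁰)| ≥ ε₀^{1/6} η_𝐣` for every `𝐣 ∈ 𝓝`, where
`η_𝐣 = (1/160) μ₁(𝐣)^{-12m} (180m)^{-4m-4} e^{-6σm}`, then `ε z⁰ ∈ Θ_ε` for all `ε ∈ (0, ε₀]`. -/
theorem stmt17 (σ θ : ℝ) (hσ : 0 < σ) (hθ : θ ∈ Set.Ioo (0 : ℝ) 1) :
    ∃ εs : ℝ, 0 < εs ∧ ∀ ε₀ : ℝ, 0 < ε₀ → ε₀ ≤ εs →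
      ∀ z0 : ℤ → ℂ, inG σ θ z0 → gNorm σ θ z0 ≤ 1 →
      (∀ m : ℕ, 1 ≤ m → ∀ j : Fin (2 * m) → ℤ × ℤ, inR j → ¬ integ j →
        ε₀ ^ ((1 : ℝ) / 6) *
          ((1 / 160) * ((mu1 j : ℝ) ^ (12 * m))⁻¹ * ((180 * m : ℝ) ^ (4 * m + 4))⁻¹ *
            Real.exp (-(6 * σ * m)))
          ≤ |omegaInf j z0|) →
      ∀ ε : ℝ, 0 < ε → ε ≤ ε₀ → inTheta σ θ ε (fun a => (ε : ℂ) * z0 a) := by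
  obtain ⟨ℓ₀, hℓ₀⟩ := Filter.eventually_atTop.mp (eventually_largeLog hσ)
  refine ⟨Real.exp (-ℓ₀), Real.exp_pos _, fun ε₀ hε₀ hε₀s z0 hz h1 hω ε hε hεε₀ => ?_⟩
  obtain ⟨ℓ, hℓdef⟩ : ∃ ℓ, Real.log ε⁻¹ = ℓ := ⟨_, rfl⟩
  have hεexp : ε = Real.exp (-ℓ) := by
    rw [← hℓdef, Real.log_inv, neg_neg, Real.exp_log hε]
  have hℓ : LargeLog σ ℓ := by
    refine hℓ₀ ℓ ?_
    have : Real.exp (-ℓ) ≤ Real.exp (-ℓ₀) := hεexp ▸ hεε₀.trans hε₀s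
    linarith [Real.exp_le_exp.mp this]
  intro m hm j hR hj hmr hbrk
  have hθ0 := hθ.1
  have hθ1 := hθ.2
  have hm0 : (1 : ℝ) ≤ m := by exact_mod_cast hm
  have hℓ1 := hℓ.one_le
  have hlog1 := hℓ.one_le_log
  have hℓ0 : 0 < ℓ := by linarith
  set r := rEps σ θ ε with hr
  set c := min 1 σ * θ * (1 - θ) / 500 with hc
  have hcpos : 0 < c := by
    have : 0 < min 1 σ := lt_min one_pos hσ
    have : 0 < 1 - θ := by linarith
    positivity
  have hc2000 : c ≤ 1 / 2000 := by
    have h2 : θ * (1 - θ) ≤ 1 / 4 := by nlinarith [sq_nonneg (θ - 1 / 2)]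
    have h3 : 0 ≤ θ * (1 - θ) := mul_nonneg hθ0.le (by linarith)
    have h4 : min 1 σ ≤ 1 := min_le_left _ _
    rw [hc]
    nlinarith
  have hrle : (r : ℝ) * Real.log ℓ ≤ c * ℓ := by
    rw [← le_div_iff₀ (by linarith), hr, rEps, hℓdef]
    exact Nat.floor_le (by positivity)
  have hr1 : (1 : ℝ) ≤ r := by
    have : (0 : ℝ) < r := by linarith
    exact_mod_cast this
  have hm3 : (m : ℝ) ≤ 3 * r := by linarith
  have hr540 : 540 * (r : ℝ) ≤ ℓ := by
    have : (r : ℝ) ≤ r * Real.log ℓ := le_mul_of_one_le_right (by linarith) hlog1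
    have : c * ℓ ≤ 1 / 2000 * ℓ := by gcongr
    linarith
  have hL : LEps σ θ ε = 6 * r * ℓ ^ (4 / θ) := by
    rw [LEps, NEps, hℓdef, ← Real.rpow_natCast, ← Real.rpow_mul hℓ0.le]
    congr 2
    push_cast
    ring
  have hNpos : 0 < ℓ ^ (4 / θ) := Real.rpow_pos_of_pos hℓ0 _
  have hL0 : 0 ≤ LEps σ θ ε := by rw [hL]; positivity
  have hLle : LEps σ θ ε ≤ ℓ ^ (1 + 4 / θ) := by
    rw [hL, Real.rpow_add hℓ0, Real.rpow_one]
    gcongr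
    linarith
  have hLθ : ℓ ^ 4 ≤ LEps σ θ ε ^ θ := by
    have h2 : ℓ ^ (4 / θ) ≤ LEps σ θ ε := by
      rw [hL]
      exact le_mul_of_one_le_left hNpos.le (by linarith)
    calc ℓ ^ 4 = (ℓ ^ (4 / θ)) ^ θ := by
          rw [← Real.rpow_mul hℓ0.le, div_mul_cancel₀ _ hθ0.ne']
          exact_mod_cast (Real.rpow_natCast ℓ 4).symm
      _ ≤ _ := Real.rpow_le_rpow hNpos.le h2 hθ0.le
  have : NeZero (2 * m) := ⟨by omega⟩
  have hη := lt_eta hσ hθ hℓ hm (μ := mu1 j)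
    (by
      calc (m : ℝ) * Real.log ℓ ≤ 3 * r * Real.log ℓ := by gcongr
        _ ≤ 3 * c * ℓ := by linarith)
    (by linarith) (by exact_mod_cast one_le_mu1 j) ((mu1_le hL0 j hbrk).trans hLle)
  have hlow := hω m hm j hR hj
  have hroot : Real.exp (-(ℓ / 6)) ≤ ε₀ ^ ((1 : ℝ) / 6) := by
    calc Real.exp (-(ℓ / 6)) = ε ^ ((1 : ℝ) / 6) := by
          rw [hεexp, ← Real.exp_mul]
          ring_nf
      _ ≤ _ := Real.rpow_le_rpow hε.le hεε₀ (by norm_num)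
  have hInf : 11 * Real.exp (-(ℓ / 2)) < |omegaInf j z0| := by
    calc 11 * Real.exp (-(ℓ / 2)) = Real.exp (-(ℓ / 6)) * (11 * Real.exp (-(ℓ / 3))) := by
          rw [mul_left_comm, ← Real.exp_add]
          ring_nf
      _ < Real.exp (-(ℓ / 6)) * _ := mul_lt_mul_of_pos_left hη (Real.exp_pos _)
      _ ≤ _ := (mul_le_mul_of_nonneg_right hroot (by positivity)).trans hlow
  have htail : |omegaInf j z0 - omegaM (LEps σ θ ε) j z0| ≤ Real.exp (-(ℓ / 2)) :=
    (abs_omegaInf_sub_omegaM_le hσ hθ0 hL0 hz h1 j hR.1.1).trans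
      (mul_exp_neg_tail_le hσ hℓ (by push_cast; linarith) hLθ)
  have hM : 10 * Real.exp (-(ℓ / 2)) < |omegaM (LEps σ θ ε) j z0| := by
    linarith [abs_sub_abs_le_abs_sub (omegaInf j z0) (omegaM (LEps σ θ ε) j z0)]
  rw [omegaM_PiM_smul, abs_mul, abs_of_nonneg (sq_nonneg ε)]
  calc 10 * dEps ε = ε ^ 2 * (10 * Real.exp (-(ℓ / 2))) := by
        rw [dEps, hεexp, ← Real.exp_mul, ← Real.exp_nat_mul, mul_left_comm, ← Real.exp_add]
        push_cast
        ring_nf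
    _ < _ := mul_lt_mul_of_pos_left hM (by positivity)
end
end
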